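/- Let V₁ and V₂ be finite dimensional complex vector spaces, and let ν be a partition of length at most dim V₁ + dim V₁·dim V₂ + dim V₂. As a representation of GL(V₁) × GL(V₂) (acting naturally on V₁ ⊕ (V₁ ⊗ V₂) ⊕ V₂ by g₁ on V₁, g₂ on V₂, and g₁⊗g₂ on V₁⊗V₂), the Schur module S^ν(V₁ ⊕ (V₁⊗V₂) ⊕ V₂) decomposes as ⊕_{λ,μ} (S^λ V₁ ⊗ S^μ V₂)^{⊕ a_{λ,μ}^ν}, where a_{λ,μ}^ν are the Aguiar coefficients. -/

import Mathlib

open scoped BigOperators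
open scoped Classical

/-- A partition: a finitely supported antitone sequence of natural numbers
(the parts, indexed from 0). -/
def IsPartitionFun (f : ℕ →₀ ℕ) : Prop := ∀ ⦃i j : ℕ⦄, i ≤ j → f j ≤ f i

def Partition' : Type := {f : ℕ →₀ ℕ // IsPartitionFun f}

namespace Partition'

/-- The size `|λ|` of a partition. -/
def size (l : Partition') : ℕ := l.1.sum fun _ v => v

/-- The number of (nonzero) parts of a partition. -/
def plength (l : Partition') : ℕ := l.1.support.card

noncomputable instance : Add Partition' :=
  ⟨fun l m => ⟨l.1 + m.1, fun i j h => by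
    simp only [Finsupp.add_apply]
    exact add_le_add (l.2 h) (m.2 h)⟩⟩

noncomputable instance : SMul ℕ Partition' :=
  ⟨fun d l => ⟨d • l.1, fun i j h => by
    simp only [Finsupp.smul_apply, smul_eq_mul]
    exact Nat.mul_le_mul_left d (l.2 h)⟩⟩

/-- The one-row partition `(m)`. For `m = 0` this is the empty partition. -/
noncomputable def row (m : ℕ) : Partition' :=
  ⟨Finsupp.single 0 m, by
    intro i j h
    simp only [Finsupp.single_apply]
    split_ifs <;> omega⟩

/-- The two-row partition `(a, b)` (with `b ≤ a`). -/
noncomputable def twoRow (a b : ℕ) (hba : b ≤ a) : Partition' :=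
  ⟨Finsupp.single 0 a + Finsupp.single 1 b, by
    intro i j h
    simp only [Finsupp.add_apply, Finsupp.single_apply]
    split_ifs <;> omega⟩

/-- `youngCount n a g` is the number of fixed points of the permutation `g` acting on the
set of functions `Fin n → Fin n` whose fibre over `i` has exactly `a i` elements; i.e. the
value at `g` of the permutation character of `S_n` acting on cosets of the Young subgroup
attached to the composition `a`. It is `0` if some `a i` is negative. -/
noncomputable def youngCount (n : ℕ) (a : Fin n → ℤ) (g : Equiv.Perm (Fin n)) : ℤ :=
  if ∀ i, 0 ≤ a i then
    (Nat.card {f : Fin n → Fin n //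
      f ∘ g = f ∧ ∀ i : Fin n, Nat.card {x : Fin n // f x = i} = (a i).toNat} : ℤ)
  else 0

/-- The irreducible character of the symmetric group `S_n` attached to a partition `l`
of `n`, given by the Jacobi–Trudi determinantal formula
`χ_l = det (h_{l_i - i + j})` expanded over permutations, where `h`-products are the
permutation characters of Young subgroups. (When `size l ≠ n` this is not used.) -/
noncomputable def irrChar (n : ℕ) (l : Partition') (g : Equiv.Perm (Fin n)) : ℤ :=
  ∑ σ : Equiv.Perm (Fin n), (Equiv.Perm.sign σ : ℤ) *
    youngCount n (fun i => (l.1 i : ℤ) + ((σ i : ℕ) : ℤ) - (i : ℤ)) g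

/-- The Kronecker coefficient `g_{λ,μ,ν}`: the multiplicity of the irreducible `S_n`-module
`M_ν` in `M_λ ⊗ M_μ` (for `|λ| = |μ| = |ν| = n`), computed as the scalar product of
characters `(1/n!) ∑_{g ∈ S_n} χ_λ(g) χ_μ(g) χ_ν(g)`; it is `0` if the sizes differ. -/
noncomputable def kron (l m nu : Partition') : ℕ :=
  if size l = size nu ∧ size m = size nu then
    ((∑ g : Equiv.Perm (Fin (size nu)),
        irrChar (size nu) l g * irrChar (size nu) m g * irrChar (size nu) nu g) /
      (Nat.factorial (size nu) : ℤ)).toNat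
  else 0

/-- The standard embedding `S_a × S_b ↪ S_{a+b}`. -/
def sumEmb {a b : ℕ} (g : Equiv.Perm (Fin a)) (h : Equiv.Perm (Fin b)) :
    Equiv.Perm (Fin (a + b)) :=
  (Equiv.permCongr finSumFinEquiv) (Equiv.sumCongr g h)

/-- The Littlewood–Richardson coefficient `c_{λ,μ}^ν`: the multiplicity of `M_ν` in the
induction of `M_λ ⊠ M_μ` from `S_{|λ|} × S_{|μ|}` to `S_{|λ|+|μ|}`, computed by
Frobenius reciprocity as a scalar product of characters; it is `0` unless
`|ν| = |λ| + |μ|`. -/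
noncomputable def lr (l m nu : Partition') : ℕ :=
  if size nu = size l + size m then
    ((∑ g : Equiv.Perm (Fin (size l)), ∑ h : Equiv.Perm (Fin (size m)),
        irrChar (size l) l g * irrChar (size m) m h *
          irrChar (size l + size m) nu (sumEmb g h)) /
      ((Nat.factorial (size l) : ℤ) * (Nat.factorial (size m) : ℤ))).toNat
  else 0

/-- The Aguiar coefficient `a_{λ,μ}^ν`, defined by
`a_{λ,μ}^ν = Σ_{α,β,δ,η,ρ,τ} c_{α,β}^λ c_{η,ρ}^μ g_{β,η,δ} c_{α,δ}^τ c_{τ,ρ}^ν`. -/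
noncomputable def aguiar (l m nu : Partition') : ℕ :=
  ∑ᶠ (α : Partition') (β : Partition') (δ : Partition') (η : Partition')
    (ρ : Partition') (τ : Partition'),
    lr α β l * lr η ρ m * kron β η δ * lr α δ τ * lr τ ρ nu

end Partition'

open scoped TensorProduct DirectSum

namespace Partition'

/-- `partialSum l i` is the number of boxes in the first `i` rows of the Young diagram
of `l`. -/
noncomputable def partialSum (l : Partition') (i : ℕ) : ℕ := ∑ j ∈ Finset.range i, l.1 j

/-- The row containing the `t`-th box of the Young diagram of `l`, the boxes being numbered
`0, 1, …, |l| - 1` row by row (this is the canonical filling). -/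
noncomputable def rowOf (l : Partition') (t : ℕ) : ℕ :=
  Nat.findGreatest (fun r => partialSum l r ≤ t) t

/-- The column containing the `t`-th box of the Young diagram of `l`. -/
noncomputable def colOf (l : Partition') (t : ℕ) : ℕ := t - partialSum l (rowOf l t)

variable (R : Type*) [CommRing R]

/-- The action of a permutation `σ ∈ S_n` on the `n`-th tensor power of `M`, permuting
the tensor factors. -/
noncomputable def permAction (n : ℕ) (M : Type*) [AddCommGroup M] [Module R M]
    (σ : Equiv.Perm (Fin n)) :
    PiTensorProduct R (fun _ : Fin n => M) →ₗ[R] PiTensorProduct R (fun _ : Fin n => M) :=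
  (PiTensorProduct.reindex R (fun _ : Fin n => M) σ).toLinearMap

/-- The Young symmetrizer of the canonical tableau of shape `l` (of size `n = |l|`),
acting on the `n`-th tensor power of `M`: the sum over the column group of the signed
permutation action, composed with the sum over the row group of the permutation action. -/
noncomputable def youngSymmetrizer (l : Partition') (M : Type*) [AddCommGroup M]
    [Module R M] :
    PiTensorProduct R (fun _ : Fin (size l) => M) →ₗ[R]
      PiTensorProduct R (fun _ : Fin (size l) => M) :=
  (∑ σ ∈ Finset.univ.filter
      (fun σ : Equiv.Perm (Fin (size l)) =>
        ∀ t : Fin (size l), colOf l ((σ t : ℕ)) = colOf l (t : ℕ)),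
      ((Equiv.Perm.sign σ : ℤ) : R) • permAction R (size l) M σ) ∘ₗ
    (∑ σ ∈ Finset.univ.filter
      (fun σ : Equiv.Perm (Fin (size l)) =>
        ∀ t : Fin (size l), rowOf l ((σ t : ℕ)) = rowOf l (t : ℕ)),
      permAction R (size l) M σ)

/-- The Schur module `S^l M`: the image of the Young symmetrizer of shape `l` acting on
the `|l|`-th tensor power of `M`. -/
noncomputable def schur (l : Partition') (M : Type*) [AddCommGroup M] [Module R M] :
    Submodule R (PiTensorProduct R (fun _ : Fin (size l) => M)) :=
  LinearMap.range (youngSymmetrizer R l M)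

/-- The action of an endomorphism `g` of `M` on the `n`-th tensor power of `M`. -/
noncomputable def tpow (n : ℕ) {M : Type*} [AddCommGroup M] [Module R M] (g : M →ₗ[R] M) :
    PiTensorProduct R (fun _ : Fin n => M) →ₗ[R] PiTensorProduct R (fun _ : Fin n => M) :=
  PiTensorProduct.map (fun _ => g)

end Partition'


set_option linter.all false
namespace HD
open Finset

def ColInj {n : ℕ} (col f : Fin n → ℕ) : Prop := ∀ s t, col s = col t → f s = f t → s = t

def Tab {n : ℕ} (row col : Fin n → ℕ) : Prop :=
  ColInj col row ∧ ∀ t r, r ≤ row t → ∃ t', col t' = col t ∧ row t' = r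

lemma count_le {n : ℕ} {row col f : Fin n → ℕ} (H : Tab row col) (hf : ColInj col f) (j k : ℕ) :
    (univ.filter fun t => col t = j ∧ f t < k).card ≤
      (univ.filter fun t => col t = j ∧ row t < k).card := by
  by_cases h : ∃ t, col t = j ∧ k ≤ row t + 1
  · obtain ⟨t, rfl, ht⟩ := h
    have h1 : (univ.filter fun s => col s = col t ∧ f s < k).card ≤ k := by
      rw [← Finset.card_range k]
      apply Finset.card_le_card_of_injOn f
      · intro s hs; simpa using (by simpa using hs : _ ∧ _).2
      · intro s hs s' hs' e
        simp at hs hs'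
        exact hf _ _ (hs.1.trans hs'.1.symm) e
    refine h1.trans ?_
    conv_lhs => rw [← Finset.card_range k]
    apply Finset.card_le_card_of_surjOn row
    intro r hr
    simp at hr
    obtain ⟨t', h1, h2⟩ := H.2 t r (by omega)
    exact ⟨t', by simp [h1, h2, hr], h2⟩
  · push Not at h
    apply Finset.card_le_card
    intro t ht
    simp at ht ⊢
    exact ⟨ht.1, by have := h t ht.1; omega⟩

lemma count_split {n : ℕ} (col f : Fin n → ℕ) (k : ℕ) :
    (univ.filter fun t => f t < k).card =
      ∑ j ∈ univ.image col, (univ.filter fun t => col t = j ∧ f t < k).card := by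
  rw [Finset.card_eq_sum_card_fiberwise (f := col) (t := univ.image col) (by intro; simp)]
  refine Finset.sum_congr rfl fun j _ => ?_
  congr 1; ext t; simp [and_comm]

lemma count_bound {n : ℕ} {row col f : Fin n → ℕ} (H : Tab row col) (hf : ColInj col f) (k : ℕ) :
    (univ.filter fun t => f t < k).card ≤ (univ.filter fun t => row t < k).card := by
  rw [count_split col f, count_split col row]
  exact Finset.sum_le_sum fun j _ => count_le H hf j k

lemma exists_perm {n : ℕ} {row col f : Fin n → ℕ} (H : Tab row col) (hf : ColInj col f)
    (hc : ∀ k, (univ.filter fun t => f t < k).card = (univ.filter fun t => row t < k).card) :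
    ∃ c : Equiv.Perm (Fin n), (∀ t, col (c t) = col t) ∧ ∀ t, f t = row (c t) := by
  have key : ∀ t k, (univ.filter fun s => col s = col t ∧ f s < k).card =
      (univ.filter fun s => col s = col t ∧ row s < k).card := by
    intro t k
    have := hc k
    rw [count_split col f, count_split col row] at this
    rw [Finset.sum_eq_sum_iff_of_le (fun j _ => count_le H hf j k)] at this
    exact this _ (by simp)
  have ex : ∀ t, ∃ t', col t' = col t ∧ row t' = f t := by
    intro t
    by_contra hne
    push Not at hne
    have h1 := key t (f t + 1)
    have h2 := key t (f t)
    have h3 : (univ.filter fun s => col s = col t ∧ row s < f t + 1) =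
        (univ.filter fun s => col s = col t ∧ row s < f t) := by
      ext s; simp only [mem_filter, mem_univ, true_and]
      constructor
      · rintro ⟨a, b⟩; exact ⟨a, by have := hne s a; omega⟩
      · rintro ⟨a, b⟩; exact ⟨a, by omega⟩
    rw [h3, ← h2] at h1
    have : (univ.filter fun s => col s = col t ∧ f s < f t) ⊂
      (univ.filter fun s => col s = col t ∧ f s < f t + 1) := by
      rw [Finset.ssubset_iff_of_subset]
      · exact ⟨t, by simp, by simp⟩
      · intro s; simp; intro a b; exact ⟨a, by omega⟩
    have := Finset.card_lt_card this
    omega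
  choose c hc1 hc2 using ex
  have hinj : Function.Injective c := by
    intro s t h
    apply hf
    · rw [← hc1, ← hc1 t, h]
    · rw [← hc2, ← hc2 t, h]
  exact ⟨Equiv.ofBijective c (Finite.injective_iff_bijective.1 hinj), hc1, fun t => (hc2 t).symm⟩

open Partition'

lemma partialSum_succ (l : Partition') (r : ℕ) :
    partialSum l (r+1) = partialSum l r + l.1 r := by
  simp [partialSum, Finset.sum_range_succ]

lemma partialSum_mono (l : Partition') : Monotone (partialSum l) :=
  monotone_nat_of_le_succ fun r => by rw [partialSum_succ]; omega

lemma zero_of_ge_size (l : Partition') {r : ℕ} (h : size l ≤ r) : l.1 r = 0 := by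
  by_contra hr
  have h1 : ∀ i ∈ range (r+1), 1 ≤ l.1 i := fun i hi => by
    have := l.2 (show i ≤ r by simp at hi; omega); omega
  have h2 : range (r+1) ⊆ l.1.support := fun i hi => by
    have := h1 i hi; simp; omega
  have : r + 1 ≤ size l := by
    unfold size Finsupp.sum
    calc r + 1 = ∑ i ∈ range (r+1), 1 := by simp
      _ ≤ ∑ i ∈ range (r+1), l.1 i := Finset.sum_le_sum h1
      _ ≤ _ := Finset.sum_le_sum_of_subset h2
  omega

lemma partialSum_eq_size (l : Partition') {r : ℕ} (h : size l ≤ r) : partialSum l r = size l := by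
  unfold partialSum
  rw [size, Finsupp.sum]
  symm
  apply Finset.sum_subset
  · intro i hi
    simp at hi ⊢
    by_contra h'
    exact hi (zero_of_ge_size l (by omega))
  · intro i _ hi; simpa using hi

lemma partialSum_le_size (l : Partition') (r : ℕ) : partialSum l r ≤ size l := by
  rw [← partialSum_eq_size l (le_max_left (size l) r)]
  exact partialSum_mono l (le_max_right _ _)

lemma le_partialSum (l : Partition') {r : ℕ} (h : l.1 r ≠ 0) : ∀ s ≤ r, s ≤ partialSum l s := by
  intro s hs
  induction s with
  | zero => simp
  | succ s ih =>
    rw [partialSum_succ]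
    have := ih (by omega)
    have := l.2 (show s ≤ r by omega)
    omega

lemma rowOf_eq (l : Partition') {r j : ℕ} (hj : j < l.1 r) : rowOf l (partialSum l r + j) = r := by
  unfold rowOf
  have hr : r ≤ partialSum l r + j := (le_partialSum l (r := r) (by omega) r le_rfl).trans (by omega)
  rw [Nat.findGreatest_eq_iff]
  refine ⟨hr, fun _ => by omega, ?_⟩
  intro k hk _ hle
  have := partialSum_mono l (show r + 1 ≤ k by omega)
  rw [partialSum_succ] at this
  omega

lemma colOf_eq (l : Partition') {r j : ℕ} (hj : j < l.1 r) : colOf l (partialSum l r + j) = j := by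
  unfold colOf; rw [rowOf_eq l hj]; omega

lemma box_lt (l : Partition') {r j : ℕ} (hj : j < l.1 r) : partialSum l r + j < size l := by
  have := partialSum_le_size l (r+1)
  rw [partialSum_succ] at this; omega

lemma box_spec (l : Partition') {t : ℕ} (ht : t < size l) :
    partialSum l (rowOf l t) + colOf l t = t ∧ colOf l t < l.1 (rowOf l t) := by
  have h1 : ∃ r, t < partialSum l (r + 1) := ⟨size l, by rw [partialSum_eq_size l (by omega)]; exact ht⟩
  have h2 := Nat.find_spec h1
  set r := Nat.find h1 with hr
  have h3 : partialSum l r ≤ t := by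
    rcases Nat.eq_zero_or_pos r with h0 | h0
    · rw [h0]; simp [partialSum]
    · have := Nat.find_min h1 (m := r - 1) (by omega)
      rw [Nat.sub_add_cancel h0] at this; omega
  rw [partialSum_succ] at h2
  have e : t = partialSum l r + (t - partialSum l r) := by omega
  have hj : t - partialSum l r < l.1 r := by omega
  rw [e, rowOf_eq l hj, colOf_eq l hj]
  exact ⟨by omega, hj⟩

lemma tab (l : Partition') {n : ℕ} (hn : size l = n) :
    Tab (fun t : Fin n => rowOf l t) (fun t : Fin n => colOf l t) := by
  subst hn
  constructor
  · intro s t h1 h2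
    have hs := box_spec l s.2
    have ht := box_spec l t.2
    simp only at h1 h2
    rw [h1, h2] at hs
    exact Fin.ext (hs.1.symm.trans ht.1)
  · intro t r hr
    have ht := box_spec l t.2
    have hj : colOf l t < l.1 r := lt_of_lt_of_le ht.2 (l.2 hr)
    exact ⟨⟨_, box_lt l hj⟩, colOf_eq l hj, rowOf_eq l hj⟩

lemma card_row (l : Partition') {n : ℕ} (hn : size l = n) (i : ℕ) :
    (univ.filter fun t : Fin n => rowOf l t = i).card = l.1 i := by
  subst hn
  rw [← Finset.card_range (l.1 i)]
  apply Finset.card_bij (fun (t : Fin (size l)) _ => colOf l t)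
  · intro t ht
    have := box_spec l t.2
    simp at ht ⊢
    rw [ht] at this; exact this.2
  · intro s hs t ht h
    simp at hs ht
    exact (tab l rfl).1 s t h (hs.trans ht.symm)
  · intro j hj
    simp at hj
    exact ⟨⟨_, box_lt l hj⟩, by simp [rowOf_eq l hj], colOf_eq l hj⟩

lemma rowOf_lt (l : Partition') {n : ℕ} (hn : size l = n) (t : Fin n) : rowOf l t < n := by
  subst hn
  by_contra h
  have := (box_spec l t.2).2
  rw [zero_of_ge_size l (by omega)] at this
  omega

end HD

namespace HD
open Finset

section GA
variable {n : ℕ}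

local notation "𝔸" n => MonoidAlgebra ℂ (Equiv.Perm (Fin n))

/-- basis element -/
noncomputable def gg (y : Equiv.Perm (Fin n)) : 𝔸 n := MonoidAlgebra.single y 1

noncomputable def stabSum {κ : Type*} (f : Fin n → κ) : 𝔸 n :=
  ∑ σ ∈ univ.filter (fun σ : Equiv.Perm (Fin n) => ∀ t, f (σ t) = f t), gg σ

noncomputable def altSum {κ : Type*} (f : Fin n → κ) : 𝔸 n :=
  ∑ σ ∈ univ.filter (fun σ : Equiv.Perm (Fin n) => ∀ t, f (σ t) = f t),
    ((Equiv.Perm.sign σ : ℤ) : ℂ) • gg σ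

lemma gg_mul (x y : Equiv.Perm (Fin n)) : gg (x * y) = gg x * gg y := by simp [gg]

lemma gg_one : (gg 1 : 𝔸 n) = 1 := rfl

lemma gg_mul_apply (x y : Equiv.Perm (Fin n)) (u : 𝔸 n) : (gg x * u).coeff y = u.coeff (x⁻¹ * y) := by
  simp [gg, MonoidAlgebra.coeff_single_mul_apply]

lemma mul_gg_apply (x y : Equiv.Perm (Fin n)) (u : 𝔸 n) : (u * gg x).coeff y = u.coeff (y * x⁻¹) := by
  simp [gg, MonoidAlgebra.coeff_mul_single_apply]

lemma eq_sum_gg (u : 𝔸 n) : u = ∑ σ, u.coeff σ • gg σ := by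
  ext y
  simp [gg, MonoidAlgebra.coeff_sum, Finsupp.finsetSum_apply, MonoidAlgebra.coeff_single, Finsupp.single_apply]

lemma mul_apply_one (u v : 𝔸 n) : (u * v).coeff 1 = ∑ σ, u.coeff σ * v.coeff σ⁻¹ := by
  conv_lhs => rw [eq_sum_gg u, Finset.sum_mul]
  simp [MonoidAlgebra.coeff_sum, Finsupp.finsetSum_apply, gg_mul_apply]

lemma mul_comm_one (u v : 𝔸 n) : (u * v).coeff 1 = (v * u).coeff 1 := by
  rw [mul_apply_one, mul_apply_one, ← Equiv.sum_comp (Equiv.inv _)]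
  simp [mul_comm]

variable {κ : Type*} (f : Fin n → κ)

lemma stab_mul_gg {s : Equiv.Perm (Fin n)} (hs : ∀ t, f (s t) = f t) :
    stabSum f * gg s = stabSum f := by
  unfold stabSum
  rw [Finset.sum_mul]
  apply Finset.sum_bij (fun σ _ => σ * s)
  · intro σ h; simp at h ⊢; intro t; rw [h, hs]
  · intro a _ b _ h; simpa using h
  · intro σ h
    refine ⟨σ * s⁻¹, ?_, by simp⟩
    simp at h ⊢; intro t; rw [h, ← hs]; simp
  · intro σ _; rw [gg_mul]

lemma gg_mul_stab {s : Equiv.Perm (Fin n)} (hs : ∀ t, f (s t) = f t) :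
    gg s * stabSum f = stabSum f := by
  unfold stabSum
  rw [Finset.mul_sum]
  apply Finset.sum_bij (fun σ _ => s * σ)
  · intro σ h; simp at h ⊢; intro t; rw [hs, h]
  · intro a _ b _ h; simpa using h
  · intro σ h
    refine ⟨s⁻¹ * σ, ?_, by simp⟩
    simp at h ⊢; intro t; have := hs (s⁻¹ (σ t)); simp at this; exact this.symm.trans (h t)
  · intro σ _; rw [gg_mul]

lemma sign_sq (s : Equiv.Perm (Fin n)) :
    ((Equiv.Perm.sign s : ℤ) : ℂ) * ((Equiv.Perm.sign s : ℤ) : ℂ) = 1 := by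
  rw [← Int.cast_mul, ← Units.val_mul, Int.units_mul_self]; simp

lemma alt_mul_gg {s : Equiv.Perm (Fin n)} (hs : ∀ t, f (s t) = f t) :
    altSum f * gg s = ((Equiv.Perm.sign s : ℤ) : ℂ) • altSum f := by
  unfold altSum
  rw [Finset.sum_mul, Finset.smul_sum]
  apply Finset.sum_bij (fun σ _ => σ * s)
  · intro σ h; simp at h ⊢; intro t; rw [h, hs]
  · intro a _ b _ h; simpa using h
  · intro σ h
    refine ⟨σ * s⁻¹, ?_, by simp⟩
    simp at h ⊢; intro t; rw [h, ← hs]; simp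
  · intro σ _
    rw [gg_mul, smul_smul, Equiv.Perm.sign_mul, Units.val_mul, Int.cast_mul, mul_comm, mul_assoc,
      sign_sq, mul_one, smul_mul_assoc]

lemma gg_mul_alt {s : Equiv.Perm (Fin n)} (hs : ∀ t, f (s t) = f t) :
    gg s * altSum f = ((Equiv.Perm.sign s : ℤ) : ℂ) • altSum f := by
  unfold altSum
  rw [Finset.mul_sum, Finset.smul_sum]
  apply Finset.sum_bij (fun σ _ => s * σ)
  · intro σ h; simp at h ⊢; intro t; rw [hs, h]
  · intro a _ b _ h; simpa using h
  · intro σ h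
    refine ⟨s⁻¹ * σ, ?_, by simp⟩
    simp at h ⊢; intro t; have := hs (s⁻¹ (σ t)); simp at this; exact this.symm.trans (h t)
  · intro σ _
    rw [gg_mul, smul_smul, Equiv.Perm.sign_mul, Units.val_mul, Int.cast_mul, ← mul_assoc,
      sign_sq, one_mul, mul_smul_comm]

lemma stab_apply (y : Equiv.Perm (Fin n)) :
    (stabSum f).coeff y = if ∀ t, f (y t) = f t then 1 else 0 := by
  simp [stabSum, gg, MonoidAlgebra.coeff_sum, Finsupp.finsetSum_apply, MonoidAlgebra.coeff_single, Finsupp.single_apply]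

lemma alt_apply (y : Equiv.Perm (Fin n)) :
    (altSum f).coeff y = if ∀ t, f (y t) = f t then ((Equiv.Perm.sign y : ℤ) : ℂ) else 0 := by
  simp [altSum, gg, MonoidAlgebra.coeff_sum, Finsupp.finsetSum_apply, MonoidAlgebra.coeff_single, Finsupp.single_apply]


lemma isStab_inv {s : Equiv.Perm (Fin n)} (hs : ∀ t, f (s t) = f t) (t : Fin n) : f (s⁻¹ t) = f t := by
  have := hs (s⁻¹ t)
  simp at this
  exact this.symm

lemma card_comp_perm (g : Fin n → ℕ) (y : Equiv.Perm (Fin n)) (k : ℕ) :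
    (univ.filter fun t => g (y t) < k).card = (univ.filter fun t => g t < k).card := by
  apply Finset.card_bij (fun t _ => y t)
  · intro t; simp
  · intro a _ b _ h; simpa using h
  · intro t ht; exact ⟨y⁻¹ t, by simpa using ht, by simp⟩

lemma dichotomy {row col : Fin n → ℕ} (H : Tab row col) (y : Equiv.Perm (Fin n)) :
    (∃ r s : Equiv.Perm (Fin n), (∀ t, row (r t) = row t) ∧ (∀ t, col (s t) = col t) ∧ y = r * s) ∨
    (∃ t : Equiv.Perm (Fin n), Equiv.Perm.sign t = -1 ∧ (∀ u, col (t u) = col u) ∧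
      ∀ u, row ((y * t * y⁻¹) u) = row u) := by
  by_cases h : ColInj col (fun t => row (y t))
  · left
    obtain ⟨s, hs1, hs2⟩ := exists_perm H h (card_comp_perm row y)
    refine ⟨y * s⁻¹, s, ?_, hs1, by simp⟩
    intro t
    have := hs2 (s⁻¹ t)
    simpa using this
  · right
    unfold ColInj at h
    push Not at h
    obtain ⟨i, j, h1, h2, h3⟩ := h
    refine ⟨Equiv.swap i j, Equiv.Perm.sign_swap h3, ?_, ?_⟩
    · intro u
      rcases Equiv.swap_apply_def i j u with e
      rw [e]; split_ifs with ha hb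
      · rw [ha, h1]
      · rw [hb, h1]
      · rfl
    · intro u
      rw [← Equiv.swap_apply_apply, Equiv.swap_apply_def]
      split_ifs with ha hb
      · rw [ha, h2]
      · rw [hb, h2]
      · rfl


noncomputable def kap (row col : Fin n → ℕ) (y : Equiv.Perm (Fin n)) : ℂ :=
  (stabSum row * altSum col).coeff y

lemma kap_one {row col : Fin n → ℕ} (H : Tab row col) : kap row col 1 = 1 := by
  unfold kap
  rw [mul_apply_one, Finset.sum_eq_single 1]
  · simp [stab_apply, alt_apply]
  · intro σ _ hσ
    rw [stab_apply, alt_apply]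
    split_ifs with h1 h2
    · exfalso; apply hσ
      ext u
      have h3 := isStab_inv col h2 u
      rw [inv_inv] at h3
      rw [H.1 (σ u) u h3 (h1 u)]; rfl
    all_goals simp
  · simp

lemma kap_fac {row col : Fin n → ℕ} (H : Tab row col) {r s : Equiv.Perm (Fin n)}
    (hr : ∀ t, row (r t) = row t) (hs : ∀ t, col (s t) = col t) :
    kap row col (r * s) = ((Equiv.Perm.sign s : ℤ) : ℂ) := by
  have h1 : (gg r⁻¹ * (stabSum row * altSum col) * gg s⁻¹).coeff 1 = kap row col (r * s) := by
    rw [mul_gg_apply, gg_mul_apply]; simp [kap]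
  rw [← h1, ← mul_assoc, gg_mul_stab row (isStab_inv row hr), mul_assoc,
    alt_mul_gg col (isStab_inv col hs), mul_smul_comm, MonoidAlgebra.coeff_smul_apply]
  have := kap_one H
  unfold kap at this
  rw [this]; simp

lemma kap_zero {row col : Fin n → ℕ} {y t : Equiv.Perm (Fin n)}
    (ht : Equiv.Perm.sign t = -1) (hc : ∀ u, col (t u) = col u)
    (hrow : ∀ u, row ((y * t * y⁻¹) u) = row u) : kap row col y = 0 := by
  have h2 : (gg (y * t * y⁻¹)⁻¹ * (stabSum row * altSum col)).coeff (y * t⁻¹) =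
      kap row col y := by
    rw [gg_mul_apply]; unfold kap; congr 1; group
  have h3 : ((stabSum row * altSum col) * gg t).coeff y =
      (stabSum row * altSum col).coeff (y * t⁻¹) := mul_gg_apply _ _ _
  rw [← mul_assoc, gg_mul_stab row (isStab_inv row hrow), ← h3, mul_assoc, alt_mul_gg col hc, ht,
    mul_smul_comm, MonoidAlgebra.coeff_smul_apply] at h2
  change _ • kap row col y = _ at h2
  simp at h2
  exact CharZero.neg_eq_self_iff.1 h2

lemma eq_zero_of_neg {u : 𝔸 n} (h : u = -u) : u = 0 := by
  have : (2:ℂ) • u = 0 := by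
    rw [two_smul]; nth_rw 2 [h]; simp
  exact (smul_eq_zero.1 this).resolve_left two_ne_zero

lemma a_y_b {row col : Fin n → ℕ} (H : Tab row col) (y : Equiv.Perm (Fin n)) :
    stabSum row * gg y * altSum col = kap row col y • (stabSum row * altSum col) := by
  rcases dichotomy H y with ⟨r, s, hr, hs, rfl⟩ | ⟨t, ht, hc, hrow⟩
  · rw [kap_fac H hr hs, gg_mul, ← mul_assoc, stab_mul_gg row hr, mul_assoc, gg_mul_alt col hs,
      mul_smul_comm]
  · rw [kap_zero ht hc hrow, zero_smul]
    apply eq_zero_of_neg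
    conv_lhs => rw [← stab_mul_gg row hrow, mul_assoc (stabSum row), ← gg_mul, inv_mul_cancel_right,
        gg_mul, ← mul_assoc, mul_assoc, gg_mul_alt col hc, ht]
    simp

lemma b_y_a {row col : Fin n → ℕ} (H : Tab row col) (y : Equiv.Perm (Fin n)) :
    altSum col * gg y * stabSum row = kap row col y⁻¹ • (altSum col * stabSum row) := by
  rcases dichotomy H y⁻¹ with ⟨r, s, hr, hs, h⟩ | ⟨t, ht, hc, hrow⟩
  · rw [h, kap_fac H hr hs]
    have : y = s⁻¹ * r⁻¹ := by rw [← inv_inv y, h]; simp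
    rw [this, gg_mul, ← mul_assoc, alt_mul_gg col (isStab_inv col hs), mul_assoc,
      gg_mul_stab row (isStab_inv row hr)]
    simp
  · rw [kap_zero ht hc hrow, zero_smul]
    apply eq_zero_of_neg
    have e : t * y = y * (y⁻¹ * t * y) := by group
    have h1 : altSum col * gg t * gg y * stabSum row = altSum col * gg y * stabSum row := by
      rw [mul_assoc (altSum col), ← gg_mul, e, gg_mul, ← mul_assoc, mul_assoc]
      congr 1
      apply gg_mul_stab
      simpa using hrow
    rw [alt_mul_gg col hc, ht] at h1
    simpa using h1.symm

lemma c_coeff {row col : Fin n → ℕ} (H : Tab row col) (y : Equiv.Perm (Fin n)) :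
    (altSum col * stabSum row).coeff y = kap row col y⁻¹ := by
  have h1 : (altSum col * stabSum row * gg y⁻¹).coeff 1 = (altSum col * stabSum row).coeff y := by
    rw [mul_gg_apply]; simp
  rw [← h1, mul_assoc, mul_comm_one, a_y_b H, MonoidAlgebra.coeff_smul_apply]
  have := kap_one H
  unfold kap at this ⊢
  rw [this]; simp

noncomputable def hh (row col : Fin n → ℕ) : ℂ := ∑ y, kap row col y * kap row col y⁻¹

lemma c_sq {row col : Fin n → ℕ} (H : Tab row col) :
    (altSum col * stabSum row) * (altSum col * stabSum row) =
    hh row col • (altSum col * stabSum row) := by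
  have : (altSum col * stabSum row) * (altSum col * stabSum row) =
    altSum col * (stabSum row * altSum col) * stabSum row := by simp only [mul_assoc]
  rw [this, eq_sum_gg (stabSum row * altSum col), Finset.mul_sum, Finset.sum_mul, hh, Finset.sum_smul]
  refine Finset.sum_congr rfl fun y _ => ?_
  rw [mul_smul_comm, smul_mul_assoc, b_y_a H, smul_smul]; rfl

/-- standard basis of the group algebra -/
noncomputable def gaBasis (n : ℕ) : Module.Basis (Equiv.Perm (Fin n)) ℂ (𝔸 n) :=
  ⟨MonoidAlgebra.coeffLinearEquiv ℂ⟩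

lemma trace_LR (s : Equiv.Perm (Fin n)) (u : 𝔸 n) :
    LinearMap.trace ℂ (𝔸 n) (LinearMap.mulLeft ℂ (gg s) ∘ₗ LinearMap.mulRight ℂ u) =
      ∑ x, u.coeff (x * s⁻¹ * x⁻¹) := by
  rw [LinearMap.trace_eq_matrix_trace ℂ (gaBasis n), Matrix.trace]
  rw [← Equiv.sum_comp (Equiv.inv _)]
  refine Finset.sum_congr rfl fun x _ => ?_
  have h1 : gaBasis n x⁻¹ = gg x⁻¹ := by
    simp [gaBasis, gg]
  rw [Matrix.diag_apply, LinearMap.toMatrix_apply]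
  simp only [Equiv.inv_apply, h1]
  change (gg s * (gg x⁻¹ * u)).coeff x⁻¹ = _
  rw [gg_mul_apply, gg_mul_apply]
  simp [mul_assoc]

lemma hh_ne_zero {row col : Fin n → ℕ} (H : Tab row col) : hh row col ≠ 0 := by
  intro h0
  have h1 := c_sq H
  rw [h0, zero_smul] at h1
  have h2 := trace_LR 1 (altSum col * stabSum row)
  have h3 : ∑ x : Equiv.Perm (Fin n), (altSum col * stabSum row).coeff (x * 1⁻¹ * x⁻¹) =
      (Nat.factorial n : ℂ) := by
    simp only [c_coeff H]
    simp [kap_one H, Fintype.card_perm]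
  rw [h3] at h2
  have h4 : IsNilpotent (LinearMap.mulLeft ℂ (gg 1) ∘ₗ
      LinearMap.mulRight ℂ (altSum col * stabSum row)) := by
    refine ⟨2, ?_⟩
    rw [gg_one, LinearMap.mulLeft_one, LinearMap.id_comp, LinearMap.pow_mulRight, pow_two, h1]
    simp
  have h5 := LinearMap.isNilpotent_trace_of_isNilpotent h4
  rw [h2] at h5
  have h6 := h5.eq_zero
  exact Nat.factorial_ne_zero n (by exact_mod_cast h6)

end GA
end HD

namespace HD
open Finset

section chi
variable {n : ℕ}

noncomputable def chi (row col : Fin n → ℕ) (σ : Equiv.Perm (Fin n)) : ℂ :=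
  (hh row col)⁻¹ * ∑ x, (altSum col * stabSum row).coeff (x * σ * x⁻¹)

def IsClass (φ : Equiv.Perm (Fin n) → ℂ) : Prop := ∀ x σ, φ (x * σ * x⁻¹) = φ σ

lemma IsClass.inv {φ : Equiv.Perm (Fin n) → ℂ} (h : IsClass φ) (σ : Equiv.Perm (Fin n)) :
    φ σ⁻¹ = φ σ := by
  have : IsConj σ σ⁻¹ := by
    rw [Equiv.Perm.isConj_iff_cycleType_eq, Equiv.Perm.cycleType_inv]
  obtain ⟨x, hx⟩ := isConj_iff.1 this
  rw [← hx, h]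

lemma chi_class (row col : Fin n → ℕ) : IsClass (chi row col) := by
  intro x σ
  unfold chi
  congr 1
  rw [← Equiv.sum_comp (Equiv.mulRight x⁻¹)]
  refine Finset.sum_congr rfl fun y _ => ?_
  congr 1
  simp [mul_assoc]

lemma inner_chi (row col : Fin n → ℕ) {φ : Equiv.Perm (Fin n) → ℂ} (h : IsClass φ) :
    ∑ σ, chi row col σ * φ σ =
      (Nat.factorial n : ℂ) * ((hh row col)⁻¹ * ∑ σ, (altSum col * stabSum row).coeff σ * φ σ) := by
  unfold chi
  simp only [mul_assoc, ← Finset.mul_sum]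
  rw [mul_left_comm]
  congr 1
  simp only [Finset.sum_mul]
  rw [Finset.sum_comm]
  have : ∀ x : Equiv.Perm (Fin n), ∑ σ, (altSum col * stabSum row).coeff (x * (σ * x⁻¹)) * φ σ =
      ∑ σ, (altSum col * stabSum row).coeff σ * φ σ := by
    intro x
    rw [← Equiv.sum_comp (MulAut.conj x).toEquiv (fun σ => (altSum col * stabSum row).coeff σ * φ σ)]
    refine Finset.sum_congr rfl fun σ _ => ?_
    simp only [MulEquiv.toEquiv_eq_coe, EquivLike.coe_coe, MulAut.conj_apply, h, mul_assoc]
    congr 1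
    rw [← mul_assoc, h]
  simp [this, Fintype.card_perm]

lemma c_one {row col : Fin n → ℕ} (H : Tab row col) :
    (altSum col * stabSum row).coeff 1 = 1 := by
  rw [c_coeff H]; simp [kap_one H]

lemma chi_norm {row col : Fin n → ℕ} (H : Tab row col) :
    ∑ σ, chi row col σ * chi row col σ = (Nat.factorial n : ℂ) := by
  rw [inner_chi row col (chi_class row col)]
  have h0 := hh_ne_zero H
  suffices h : ∑ σ, (altSum col * stabSum row).coeff σ * chi row col σ = hh row col by
    rw [h, inv_mul_cancel₀ h0, mul_one]
  have h1 : ∀ σ, chi row col σ = (hh row col)⁻¹ * ∑ x,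
      (altSum col * stabSum row).coeff (x * σ⁻¹ * x⁻¹) := fun σ => by
    rw [← (chi_class row col).inv]; rfl
  simp only [h1, mul_left_comm _ (hh row col)⁻¹, ← Finset.mul_sum]
  simp only [Finset.mul_sum]
  rw [Finset.sum_comm]
  simp only [← Finset.mul_sum]
  have h2 : ∀ y, ∑ σ, (altSum col * stabSum row).coeff σ *
      (altSum col * stabSum row).coeff (y * σ⁻¹ * y⁻¹) =
      hh row col * (kap row col y * kap row col y⁻¹) := by
    intro y
    have e : ∑ σ, (altSum col * stabSum row).coeff σ *
      (altSum col * stabSum row).coeff (y * σ⁻¹ * y⁻¹) =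
      ((altSum col * stabSum row) * (gg y⁻¹ * (altSum col * stabSum row) * gg y)).coeff 1 := by
      rw [mul_apply_one]
      refine Finset.sum_congr rfl fun σ _ => ?_
      rw [mul_gg_apply, gg_mul_apply]; simp [mul_assoc]
    have e2 : ((altSum col * stabSum row) * (gg y⁻¹ * (altSum col * stabSum row) * gg y)) =
      altSum col * (stabSum row * gg y⁻¹ * altSum col) * stabSum row * gg y := by
      simp only [mul_assoc]
    have e3 : altSum col * (stabSum row * altSum col) * stabSum row = 
       (altSum col * stabSum row) * (altSum col * stabSum row) := by simp only [mul_assoc]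
    rw [e, e2, a_y_b H, mul_smul_comm, smul_mul_assoc, e3, c_sq H, smul_mul_assoc, smul_mul_assoc,
      MonoidAlgebra.coeff_smul_apply, MonoidAlgebra.coeff_smul_apply, mul_gg_apply, c_coeff H]
    simp; ring
  simp only [h2]
  rw [← Finset.mul_sum, inv_mul_cancel_left₀ h0]
  rfl

/-! ### pairing with Young permutation characters -/

lemma sum_c_stab {row col : Fin n → ℕ} {κ : Type*} (f : Fin n → κ) :
    ∑ σ, (altSum col * stabSum row).coeff σ * (if ∀ t, f (σ t) = f t then 1 else 0) =
      (stabSum row * (stabSum f * altSum col)).coeff 1 := by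
  rw [← mul_assoc, mul_comm_one, ← mul_assoc, mul_apply_one]
  refine Finset.sum_congr rfl fun σ _ => ?_
  rw [stab_apply]
  congr 2
  apply propext
  refine ⟨fun h => isStab_inv f h, fun h => ?_⟩
  simpa using isStab_inv f h

lemma stab_alt_zero {col f : Fin n → ℕ} (h : ¬ ColInj col f) : stabSum f * altSum col = 0 := by
  unfold ColInj at h
  push Not at h
  obtain ⟨i, j, h1, h2, h3⟩ := h
  have hs : ∀ g : Fin n → ℕ, g i = g j → ∀ u, g (Equiv.swap i j u) = g u := by
    intro g hg u
    rw [Equiv.swap_apply_def]; split_ifs with ha hb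
    · rw [ha, hg]
    · rw [hb, hg]
    · rfl
  apply eq_zero_of_neg
  conv_lhs => rw [← stab_mul_gg f (hs f h2), mul_assoc, gg_mul_alt col (hs col h1),
    Equiv.Perm.sign_swap h3]
  simp

lemma stab_comp {κ : Type*} (f : Fin n → κ) (s : Equiv.Perm (Fin n)) :
    stabSum (fun t => f (s t)) = gg s⁻¹ * stabSum f * gg s := by
  ext y
  rw [mul_gg_apply, gg_mul_apply, stab_apply, stab_apply]
  congr 1
  apply propext
  constructor
  · intro h t; have := h (s⁻¹ t); simpa using this
  · intro h t; have := h (s t); simpa using this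

lemma stab_alt_comp {row col : Fin n → ℕ} {s : Equiv.Perm (Fin n)}
    (hs : ∀ t, col (s t) = col t) :
    stabSum (fun t => row (s t)) * altSum col =
      ((Equiv.Perm.sign s : ℤ) : ℂ) • (gg s⁻¹ * (stabSum row * altSum col)) := by
  rw [stab_comp, mul_assoc, gg_mul_alt col hs]; simp [mul_assoc]

lemma altSum_inv (col : Fin n → ℕ) :
    altSum col = ∑ σ ∈ univ.filter (fun σ : Equiv.Perm (Fin n) => ∀ t, col (σ t) = col t),
      ((Equiv.Perm.sign σ : ℤ) : ℂ) • gg σ⁻¹ := by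
  unfold altSum
  apply Finset.sum_bij (fun σ _ => σ⁻¹)
  · intro σ h; simp at h ⊢; exact isStab_inv col h
  · intro a _ b _ h; simpa using h
  · intro σ h; refine ⟨σ⁻¹, ?_, by simp⟩; simp at h ⊢; exact isStab_inv col h
  · intro σ _; simp

lemma sum_alt {row col : Fin n → ℕ} (H : Tab row col) :
    ∑ s ∈ univ.filter (fun σ : Equiv.Perm (Fin n) => ∀ t, col (σ t) = col t),
      (stabSum row * (stabSum (fun t => row (s t)) * altSum col)).coeff 1 = hh row col := by
  have : ∀ s ∈ univ.filter (fun σ : Equiv.Perm (Fin n) => ∀ t, col (σ t) = col t),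
      stabSum row * (stabSum (fun t => row (s t)) * altSum col) =
      stabSum row * ((((Equiv.Perm.sign s : ℤ) : ℂ) • gg s⁻¹) * (stabSum row * altSum col)) := by
    intro s hs
    rw [stab_alt_comp (by simpa using hs)]; simp
  rw [Finset.sum_congr rfl (fun s hs => by rw [this s hs]), ← Finsupp.finsetSum_apply,
    ← MonoidAlgebra.coeff_sum, ← Finset.mul_sum, ← Finset.sum_mul, ← altSum_inv,
    ← mul_assoc, ← mul_assoc, mul_comm_one, ← mul_assoc, ← mul_assoc, mul_assoc, c_sq H,
    MonoidAlgebra.coeff_smul_apply, c_one H]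
  simp

end chi
end HD

namespace HD
open Finset Partition'

section yc
variable {n : ℕ}

noncomputable def FF (b : Fin n → ℕ) : Finset (Fin n → Fin n) :=
  univ.filter fun f => ∀ i, (univ.filter fun t => f t = i).card = b i

noncomputable def yc (b : Fin n → ℕ) (g : Equiv.Perm (Fin n)) : ℤ :=
  ∑ f ∈ FF b, if ∀ t, (f (g t) : ℕ) = f t then 1 else 0

lemma youngCount_eq (a : Fin n → ℤ) (g : Equiv.Perm (Fin n)) :
    youngCount n a g = if ∀ i, 0 ≤ a i then yc (fun i => (a i).toNat) g else 0 := by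
  unfold youngCount yc FF
  split_ifs with h
  · rw [Finset.sum_boole]
    congr 1
    rw [Nat.card_eq_fintype_card, Fintype.card_subtype, Finset.filter_filter]
    congr 1
    ext f
    simp only [mem_filter, mem_univ, true_and, Nat.card_eq_fintype_card, Fintype.card_subtype]
    rw [and_comm]
    apply and_congr Iff.rfl
    constructor
    · intro h t; exact congrArg Fin.val (congrFun h t)
    · intro h; funext t; exact Fin.ext (h t)
  · rfl

lemma FF_comp {b : Fin n → ℕ} {f : Fin n → Fin n} (h : f ∈ FF b) (x : Equiv.Perm (Fin n)) :
    f ∘ x ∈ FF b := by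
  simp only [FF, mem_filter, mem_univ, true_and] at h ⊢
  intro i
  rw [← h i]
  apply Finset.card_bij (fun t _ => x t)
  · intro t; simp
  · intro a _ b _ h; simpa using h
  · intro t ht; exact ⟨x⁻¹ t, by simpa using ht, by simp⟩

lemma yc_class (b : Fin n → ℕ) (x g : Equiv.Perm (Fin n)) : yc b (x * g * x⁻¹) = yc b g := by
  unfold yc
  apply Finset.sum_bij' (fun f _ => f ∘ x) (fun f _ => f ∘ x.symm)
  · intro f hf; exact FF_comp hf x
  · intro f hf; exact FF_comp hf x.symm
  · intro f _; funext t; simp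
  · intro f _; funext t; simp
  · intro f _
    congr 1
    apply propext
    constructor
    · intro h t; have := h (x t); simpa using this
    · intro h t; have := h (x⁻¹ t); simpa using this

lemma irrChar_class (l : Partition') : IsClass (fun g : Equiv.Perm (Fin n) => (irrChar n l g : ℂ)) := by
  intro x g
  simp only [irrChar, youngCount_eq, yc_class]

lemma FF_lt {b : Fin n → ℕ} {f : Fin n → Fin n} (h : f ∈ FF b) (k : ℕ) :
    (univ.filter fun t => (f t : ℕ) < k).card = ∑ i ∈ univ.filter (fun i : Fin n => (i : ℕ) < k), b i := by
  simp only [FF, mem_filter, mem_univ, true_and] at h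
  rw [Finset.card_eq_sum_card_fiberwise (f := f) (t := univ.filter (fun i : Fin n => (i : ℕ) < k))]
  · apply Finset.sum_congr rfl
    intro i hi
    rw [← h i, Finset.filter_filter]
    congr 1
    ext t
    simp only [mem_filter, mem_univ, true_and] at hi ⊢
    constructor
    · exact fun h => h.2
    · intro h; rw [h]; exact ⟨hi, rfl⟩
  · intro t ht; simpa using ht

lemma sum_c_stab' {row col : Fin n → ℕ} (f : Fin n → Fin n) :
    ∑ σ, (altSum col * stabSum row).coeff σ * (if ∀ t, (f (σ t) : ℕ) = f t then 1 else 0) =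
      (stabSum row * (stabSum (fun t => (f t : ℕ)) * altSum col)).coeff 1 := by
  rw [← sum_c_stab (fun t => (f t : ℕ))]
  refine Finset.sum_congr rfl fun σ _ => ?_
  congr

noncomputable def rowF (l : Partition') {n : ℕ} (hn : size l = n) : Fin n → Fin n :=
  fun t => ⟨rowOf l t, rowOf_lt l hn t⟩

lemma rowF_mem (l : Partition') (hn : size l = n) : rowF l hn ∈ FF (fun i : Fin n => l.1 i) := by
  simp only [FF, mem_filter, mem_univ, true_and]
  intro i
  rw [← card_row l hn i]
  congr 1
  ext t
  simp [rowF, Fin.ext_iff]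

variable (l : Partition') (hn : size l = n)

lemma pair_lt {b : Fin n → ℕ} (k : ℕ) (hk : ∑ i ∈ univ.filter (fun i : Fin n => (i : ℕ) < k), l.1 i <
    ∑ i ∈ univ.filter (fun i : Fin n => (i : ℕ) < k), b i) (hn : size l = n) :
    ∑ g, (altSum (fun t : Fin n => colOf l t) * stabSum (fun t : Fin n => rowOf l t)).coeff g *
      (yc b g : ℂ) = 0 := by
  simp only [yc, Int.cast_sum, Int.cast_ite, Int.cast_one, Int.cast_zero, Finset.mul_sum]
  rw [Finset.sum_comm]
  apply Finset.sum_eq_zero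
  intro f hf
  rw [sum_c_stab' f, stab_alt_zero]
  · simp
  · intro hc
    have h1 := count_bound (tab l hn) hc k
    rw [FF_lt hf] at h1
    have h2 := FF_lt (rowF_mem l hn) k
    simp only [rowF] at h2
    refine absurd (lt_of_lt_of_le hk (h1.trans (le_of_eq ?_))) (lt_irrefl _)
    rw [← h2]; congr!

lemma pair_eq (hn : size l = n) :
    ∑ g, (altSum (fun t : Fin n => colOf l t) * stabSum (fun t : Fin n => rowOf l t)).coeff g *
      (yc (fun i : Fin n => l.1 i) g : ℂ) =
      hh (fun t : Fin n => rowOf l t) (fun t : Fin n => colOf l t) := by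
  simp only [yc, Int.cast_sum, Int.cast_ite, Int.cast_one, Int.cast_zero, Finset.mul_sum]
  rw [Finset.sum_comm, ← sum_alt (tab l hn)]
  symm
  apply Finset.sum_of_injOn (fun s : Equiv.Perm (Fin n) => rowF l hn ∘ (s : Fin n → Fin n))
  · intro s hs s' hs' h
    simp only [coe_filter, mem_univ, true_and, Set.mem_ofPred_eq] at hs hs'
    ext t
    congr 1
    apply (tab l hn).1
    · exact (hs t).trans (hs' t).symm
    · have := congrFun h t
      simp only [rowF, Function.comp, Fin.ext_iff] at this
      exact this
  · intro s hs
    exact FF_comp (rowF_mem l hn) s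
  · intro f hf hni
    rw [sum_c_stab' f, stab_alt_zero]
    · simp
    · intro hc
      apply hni
      obtain ⟨c, hc1, hc2⟩ := exists_perm (tab l hn) hc (fun k => by
        rw [FF_lt hf, ← FF_lt (rowF_mem l hn)]; rfl)
      refine ⟨c, by simpa using hc1, ?_⟩
      funext t
      exact Fin.ext (hc2 t).symm
  · intro s hs
    rw [sum_c_stab' (rowF l hn ∘ s)]
    rfl

lemma pair_irr (hn : size l = n) :
    ∑ g, (altSum (fun t : Fin n => colOf l t) * stabSum (fun t : Fin n => rowOf l t)).coeff g *
      (irrChar n l g : ℂ) =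
      hh (fun t : Fin n => rowOf l t) (fun t : Fin n => colOf l t) := by
  simp only [irrChar, Int.cast_sum, Int.cast_mul, Finset.mul_sum]
  rw [Finset.sum_comm, Finset.sum_eq_single 1]
  · rw [← pair_eq l hn]
    refine Finset.sum_congr rfl fun g _ => ?_
    simp [youngCount_eq]
  · intro w _ hw
    simp only [youngCount_eq]
    split_ifs with h
    · have hex : ∃ i : Fin n, w i ≠ i := by
        by_contra hh; push Not at hh; exact hw (Equiv.ext hh)
      obtain ⟨i, hi, hmin⟩ : ∃ i : Fin n, w i ≠ i ∧ ∀ j < i, w j = j := by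
        have := (Set.toFinite {i : Fin n | w i ≠ i}).exists_minimal hex
        obtain ⟨i, hi⟩ := this
        refine ⟨i, hi.1, fun j hj => ?_⟩
        by_contra hc
        exact absurd (hi.2 hc hj.le) (not_le.2 hj)
      have hlt : i < w i := by
        rcases lt_trichotomy i (w i) with h | h | h
        · exact h
        · exact absurd h.symm hi
        · have := hmin _ h
          exact absurd (w.injective this) hi
      have := pair_lt l (b := fun i => ((l.1 i : ℤ) + ((w i : ℕ) : ℤ) - (i : ℤ)).toNat) (i + 1) (by
        apply Finset.sum_lt_sum
        · intro j hj
          simp at hj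
          rcases eq_or_lt_of_le (Fin.le_def.1 hj) with e | e
          · rw [Fin.ext e]; have := Fin.lt_def.1 hlt; omega
          · rw [hmin j e]; omega
        · refine ⟨i, by simp, ?_⟩
          have := Fin.lt_def.1 hlt; omega) hn
      simp only [mul_left_comm _ ((_ : ℤ) : ℂ)]
      rw [← Finset.mul_sum, this, mul_zero]
    · simp
  · simp

noncomputable abbrev chiP (n : ℕ) (l : Partition') : Equiv.Perm (Fin n) → ℂ :=
  chi (fun t : Fin n => rowOf l t) (fun t : Fin n => colOf l t)

lemma chi_irr (hn : size l = n) :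
    ∑ g, chiP n l g * (irrChar n l g : ℂ) = (Nat.factorial n : ℂ) := by
  rw [inner_chi _ _ (irrChar_class l), pair_irr l hn, inv_mul_cancel₀ (hh_ne_zero (tab l hn)), mul_one]

end yc
end HD

namespace HD
open Finset

section cauchy
open Polynomial
variable {R : Type*} [CommRing R] {n : ℕ}

lemma coeff_rec (E Q : R[X]) (y : R) (h : E = (1 - C y * X) * Q) (m : ℕ) :
    Q.coeff m = ∑ r ∈ range (m + 1), E.coeff (m - r) * y ^ r := by
  have h0 : E.coeff 0 = Q.coeff 0 := by rw [h]; simp [sub_mul, mul_assoc]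
  have h1 : ∀ m, E.coeff (m + 1) = Q.coeff (m + 1) - y * Q.coeff m := by
    intro m; rw [h]; simp [sub_mul, mul_assoc, coeff_X_mul]
  induction m with
  | zero => simp [h0]
  | succ m ih =>
    have : Q.coeff (m + 1) = E.coeff (m + 1) + y * Q.coeff m := by rw [h1]; ring
    rw [this, ih, Finset.sum_range_succ' _ (m + 1), Finset.mul_sum]
    simp only [Nat.add_sub_add_right, pow_zero, mul_one, Nat.sub_zero]
    rw [add_comm]
    congr 1
    refine Finset.sum_congr rfl fun r _ => ?_
    ring

noncomputable def Epol (y : Fin n → R) : R[X] := ∏ k, (1 - C (y k) * X)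
noncomputable def Qpol (y : Fin n → R) (j : Fin n) : R[X] := ∏ k ∈ univ.erase j, (1 - C (y k) * X)

lemma Epol_eq (y : Fin n → R) (j : Fin n) : Epol y = (1 - C (y j) * X) * Qpol y j :=
  (Finset.mul_prod_erase univ _ (mem_univ j)).symm

lemma Epol_zero (y : Fin n → R) : (Epol y).coeff 0 = 1 := by
  simp [Epol, coeff_zero_eq_eval_zero, eval_prod]

lemma Qpol_deg (y : Fin n → R) (j : Fin n) : (Qpol y j).natDegree < n := by
  have hn : 0 < n := j.pos
  have : (Qpol y j).natDegree ≤ ∑ k ∈ univ.erase j, 1 := by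
    refine (natDegree_prod_le _ _).trans (Finset.sum_le_sum fun k _ => ?_)
    refine (natDegree_sub_le _ _).trans ?_
    simp only [natDegree_one, zero_le, sup_of_le_right]
    exact (natDegree_C_mul_le _ _).trans natDegree_X_le
  simp [Finset.card_erase_of_mem] at this
  omega

lemma cauchy_det (x y : Fin n → R) :
    (Matrix.of fun i j => ∏ k ∈ univ.erase j, (1 - x i * y k)).det =
      (Matrix.vandermonde x).det * (Matrix.vandermonde y).det := by
  let L : Matrix (Fin n) (Fin n) R := Matrix.of fun m r =>
    if r ≤ m then (Epol y).coeff ((m : ℕ) - (r : ℕ)) else 0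
  have hL : L.det = 1 := by
    rw [Matrix.det_of_isLowerTriangular L]
    · simp [L, Epol_zero]
    · intro i j h
      simp only [L, Matrix.of_apply]
      rw [if_neg]
      exact not_le.2 (by simpa using h)
  have hM : (Matrix.of fun i j => ∏ k ∈ univ.erase j, (1 - x i * y k)) =
      Matrix.vandermonde x * (L * (Matrix.vandermonde y).transpose) := by
    ext i j
    have e1 : ∏ k ∈ univ.erase j, (1 - x i * y k) = (Qpol y j).eval (x i) := by
      rw [Qpol, eval_prod]
      refine Finset.prod_congr rfl fun k _ => ?_
      simp [mul_comm (x i)]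
    rw [Matrix.of_apply, e1, eval_eq_sum_range' (Qpol_deg y j), Finset.sum_range, Matrix.mul_apply]
    refine Finset.sum_congr rfl fun m _ => ?_
    rw [Matrix.vandermonde_apply, mul_comm]
    congr 1
    rw [coeff_rec _ _ _ (Epol_eq y j), Matrix.mul_apply]
    simp only [L, Matrix.of_apply, Matrix.transpose_apply, Matrix.vandermonde_apply, ite_mul, zero_mul]
    rw [← Finset.sum_filter]
    symm
    apply Finset.sum_bij (fun (r : Fin n) _ => (r : ℕ))
    · intro r hr; simp at hr ⊢; exact hr
    · intro a _ b _ h; exact Fin.ext h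
    · intro r hr
      simp at hr
      exact ⟨⟨r, by omega⟩, by rw [mem_filter]; exact ⟨mem_univ _, Fin.le_def.2 (by simpa using by omega)⟩, rfl⟩
    · intro r _; rfl
  rw [hM, Matrix.det_mul, Matrix.det_mul, hL, Matrix.det_transpose, one_mul]

end cauchy

section alt
variable {R : Type*} [CommRing R] {n : ℕ}

noncomputable def aalt (x : Fin n → R) : R :=
  ∑ w : Equiv.Perm (Fin n), ((Equiv.Perm.sign w : ℤ) : R) * ∏ i, x i ^ (n - 1 - (w i : ℕ))

lemma aalt_eq (x : Fin n → R) :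
    aalt x = ((Equiv.Perm.sign (Fin.revPerm : Equiv.Perm (Fin n)) : ℤ) : R) *
      (Matrix.vandermonde x).det := by
  rw [← Matrix.det_permute', ← Matrix.det_transpose, Matrix.det_apply']
  unfold aalt
  refine Finset.sum_congr rfl fun w _ => ?_
  congr 1
  refine Finset.prod_congr rfl fun i _ => ?_
  simp [Matrix.vandermonde_apply, Fin.val_rev]
  congr 1
  omega

lemma aalt_mul (x y : Fin n → R) (G : Fin n → Fin n → R) (hG : ∀ i j, (1 - x i * y j) * G i j = 1) :
    aalt x * aalt y * ∏ i, ∏ j, G i j = (Matrix.of G).det := by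
  rw [aalt_eq, aalt_eq]
  have hs : ((Equiv.Perm.sign (Fin.revPerm : Equiv.Perm (Fin n)) : ℤ) : R) *
    ((Equiv.Perm.sign (Fin.revPerm : Equiv.Perm (Fin n)) : ℤ) : R) = 1 := by
    rw [← Int.cast_mul]; simp
  have e : (Matrix.of G).det = (∏ i, ∏ j, G i j) *
      ((Matrix.vandermonde x).det * (Matrix.vandermonde y).det) := by
    rw [← cauchy_det, ← Matrix.det_mul_column]
    congr 1
    ext i j
    simp only [Matrix.of_apply]
    rw [← Finset.mul_prod_erase univ _ (mem_univ j), mul_assoc, ← Finset.prod_mul_distrib]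
    rw [Finset.prod_eq_one, mul_one]
    intro k _
    rw [mul_comm, hG]
  rw [e]
  linear_combination ((Matrix.vandermonde x).det * (Matrix.vandermonde y).det *
    ∏ i, ∏ j, G i j) * hs

end alt
end HD

namespace HD
open Finset

section burnside
variable {n : ℕ} {C : Type*} [Fintype C]

noncomputable def cnt (p : Fin n → C) (c : C) : ℕ := (univ.filter fun t => p t = c).card

lemma exists_of_cnt {p q : Fin n → C} (h : cnt p = cnt q) :
    ∃ g : Equiv.Perm (Fin n), ∀ t, p (g t) = q t := by
  have e : ∀ c, Nonempty ({t // q t = c} ≃ {t // p t = c}) := by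
    intro c
    refine ⟨Fintype.equivOfCardEq ?_⟩
    rw [Fintype.card_subtype, Fintype.card_subtype]
    exact (congrFun h c).symm
  have e := fun c => (e c).some
  let g : Equiv.Perm (Fin n) := (Equiv.sigmaFiberEquiv q).symm.trans
    ((Equiv.sigmaCongrRight e).trans (Equiv.sigmaFiberEquiv p))
  refine ⟨g, fun t => ?_⟩
  exact (e (q t) ⟨t, rfl⟩).2

lemma exists_cnt (k : C → ℕ) (hk : ∑ c, k c = n) : ∃ p : Fin n → C, cnt p = k := by
  have : Fintype.card (Σ c, Fin (k c)) = Fintype.card (Fin n) := by simp [hk]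
  let e := (Fintype.equivOfCardEq this)
  refine ⟨fun t => (e.symm t).1, ?_⟩
  funext c
  unfold cnt
  rw [← Fintype.card_subtype, ← Fintype.card_fin (k c)]
  apply Fintype.card_congr
  refine (Equiv.subtypeEquiv e.symm (q := fun s => s.1 = c) (fun _ => Iff.rfl)).trans ?_
  exact Equiv.sigmaSubtype c

lemma burnside (k : C → ℕ) (hk : ∑ c, k c = n) :
    ∑ p ∈ univ.filter (fun p : Fin n → C => cnt p = k),
      (univ.filter fun g : Equiv.Perm (Fin n) => ∀ t, p (g t) = p t).card = Nat.factorial n := by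
  obtain ⟨p0, hp0⟩ := exists_cnt k hk
  have h1 : Nat.factorial n = (univ : Finset (Equiv.Perm (Fin n))).card := by
    rw [Finset.card_univ, Fintype.card_perm, Fintype.card_fin]
  rw [h1, Finset.card_eq_sum_card_fiberwise (f := fun g : Equiv.Perm (Fin n) => p0 ∘ g)
    (t := univ.filter (fun p : Fin n → C => cnt p = k))]
  · refine Finset.sum_congr rfl fun p hp => ?_
    have hp : cnt p = k := by simpa using hp
    obtain ⟨g0, hg0⟩ := exists_of_cnt (hp0.trans hp.symm)
    apply Finset.card_bij' (fun g _ => g0 * g) (fun g _ => g0⁻¹ * g)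
    · intro g hg
      simp only [mem_filter, mem_univ, true_and] at hg ⊢
      funext t; simp [hg0, hg]
    · intro g hg
      simp only [mem_filter, mem_univ, true_and] at hg ⊢
      intro t
      rw [← hg0]
      simpa using congrFun hg t
    · intro g _; simp
    · intro g _; simp
  · intro g _
    simp only [coe_filter, mem_univ, true_and, Set.mem_ofPred_eq, ← hp0]
    funext c
    apply Finset.card_bij (fun t _ => g t)
    · intro t; simp
    · intro a _ b _ h; simpa using h
    · intro t ht; exact ⟨g⁻¹ t, by simpa using ht, by simp⟩

lemma sum_cnt (p : Fin n → C) : ∑ c, cnt p c = n := by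
  unfold cnt
  rw [← Finset.card_eq_sum_card_fiberwise (f := p) (t := univ)]
  · simp
  · intro _ _; simp

end burnside

section coefG
variable {σ : Type*} {T : Type*} [Fintype T]

noncomputable def geom (d : σ →₀ ℕ) : MvPowerSeries σ ℤ := fun m => if ∃ k : ℕ, m = k • d then 1 else 0

lemma coeff_geom (d m : σ →₀ ℕ) : MvPowerSeries.coeff m (geom d) = if ∃ k : ℕ, m = k • d then 1 else 0 := rfl

lemma geom_mul (d : σ →₀ ℕ) (hd : d ≠ 0) : (1 - MvPowerSeries.monomial d (1:ℤ)) * geom d = 1 := by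
  ext m
  rw [sub_mul, one_mul, map_sub, MvPowerSeries.coeff_monomial_mul, coeff_geom, coeff_geom,
    MvPowerSeries.coeff_one]
  by_cases hm : m = 0
  · subst hm
    rw [if_pos ⟨0, by simp⟩, if_neg, if_pos rfl]; · simp
    intro h; exact hd (le_antisymm h (zero_le))
  · rw [if_neg hm]
    by_cases hk : ∃ k : ℕ, m = k • d
    · obtain ⟨k, hk⟩ := hk
      obtain ⟨k, rfl⟩ : ∃ k', k = k' + 1 := by
        cases k with
        | zero => simp at hk; exact absurd hk hm
        | succ k => exact ⟨k, rfl⟩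
      have hle : d ≤ m := by rw [hk, succ_nsmul]; exact le_add_self
      rw [if_pos ⟨_, hk⟩, if_pos hle, if_pos ⟨k, by rw [hk, succ_nsmul]; simp⟩]; simp
    · rw [if_neg hk]
      split_ifs with h1 h2
      · obtain ⟨k, h2⟩ := h2
        exact absurd ⟨k + 1, by rw [succ_nsmul, ← h2, tsub_add_cancel_of_le h1]⟩ hk
      · simp
      · simp

lemma coeff_geom_prod (d : T → σ →₀ ℕ) (hd : ∀ t, d t ≠ 0) (m : σ →₀ ℕ)
    (S : Finset (T → ℕ)) (hS : ∀ k : T → ℕ, k ∈ S ↔ ∑ t, k t • d t = m) :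
    MvPowerSeries.coeff m (∏ t, geom (d t)) = (S.card : ℤ) := by
  rw [MvPowerSeries.coeff_prod]
  simp only [coeff_geom]
  have inj : ∀ t (a b : ℕ), a • d t = b • d t → a = b := by
    intro t a b h
    obtain ⟨s, hs⟩ : ∃ s, d t s ≠ 0 := by
      by_contra hc; push Not at hc; exact hd t (Finsupp.ext hc)
    have := DFunLike.congr_fun h s
    simp at this
    tauto
  simp only [Finset.prod_ite_zero, Finset.prod_const_one]
  rw [Finset.sum_boole]
  congr 1
  symm
  apply Finset.card_bij (fun k _ => Finsupp.equivFunOnFinite.symm (fun t => k t • d t))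
  · intro k hk
    rw [hS] at hk
    simp [Finset.mem_finsuppAntidiag, hk]
    exact fun i => ⟨k i, rfl⟩
  · intro a _ b _ h
    funext t
    exact inj t _ _ (by simpa using DFunLike.congr_fun h t)
  · intro l hl
    simp only [mem_filter, Finset.mem_finsuppAntidiag, mem_univ, forall_true_left] at hl
    choose k hk using hl.2
    refine ⟨k, ?_, ?_⟩
    · rw [hS, ← hl.1.1]
      exact Finset.sum_congr rfl fun t _ => (hk t).symm
    · ext1 t; simp [hk]

end coefG
end HD

namespace HD
open Finset Partition'

section ortho
variable {n : ℕ}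

noncomputable def KK (α β : Fin n → ℕ) : Finset (Fin n × Fin n → ℕ) :=
  (Fintype.piFinset fun _ => range (∑ i, α i + 1)).filter fun k =>
    (∀ i, ∑ j, k (i, j) = α i) ∧ ∀ j, ∑ i, k (i, j) = β j

lemma mem_KK {α β : Fin n → ℕ} {k : Fin n × Fin n → ℕ} :
    k ∈ KK α β ↔ (∀ i, ∑ j, k (i, j) = α i) ∧ ∀ j, ∑ i, k (i, j) = β j := by
  unfold KK
  rw [mem_filter, and_iff_right_iff_imp]
  rintro ⟨h1, _⟩
  rw [Fintype.mem_piFinset]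
  rintro ⟨i, j⟩
  rw [mem_range, Nat.lt_succ_iff]
  calc k (i, j) ≤ ∑ j, k (i, j) := Finset.single_le_sum (f := fun j => k (i, j)) (fun _ _ => Nat.zero_le _) (mem_univ j)
    _ = α i := h1 i
    _ ≤ _ := Finset.single_le_sum (fun _ _ => Nat.zero_le _) (mem_univ i)

lemma cnt_fst (p : Fin n → Fin n × Fin n) (i : Fin n) :
    ∑ j, cnt p (i, j) = (univ.filter fun t => (p t).1 = i).card := by
  unfold cnt
  rw [Finset.card_eq_sum_card_fiberwise (f := fun t => (p t).2) (t := univ) (by intro _ _; simp)]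
  refine Finset.sum_congr rfl fun j _ => ?_
  rw [Finset.filter_filter]
  congr 1; ext t; simp [Prod.ext_iff]

lemma cnt_snd (p : Fin n → Fin n × Fin n) (j : Fin n) :
    ∑ i, cnt p (i, j) = (univ.filter fun t => (p t).2 = j).card := by
  unfold cnt
  rw [Finset.card_eq_sum_card_fiberwise (f := fun t => (p t).1) (t := univ) (by intro _ _; simp)]
  refine Finset.sum_congr rfl fun j _ => ?_
  rw [Finset.filter_filter]
  congr 1; ext t; simp [Prod.ext_iff, and_comm]

lemma yc_inner (α β : Fin n → ℕ) (hα : ∑ i, α i = n) :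
    ∑ g, yc α g * yc β g = (Nat.factorial n : ℤ) * (KK α β).card := by
  have h1 : ∀ g : Equiv.Perm (Fin n), yc α g * yc β g =
      ∑ p ∈ univ.filter (fun p : Fin n → Fin n × Fin n => cnt p ∈ KK α β),
        if ∀ t, p (g t) = p t then (1 : ℤ) else 0 := by
    intro g
    unfold yc
    rw [Finset.sum_mul_sum, ← Finset.sum_product']
    refine Finset.sum_bij' (fun q _ t => (q.1 t, q.2 t)) (fun p _ => (fun t => (p t).1, fun t => (p t).2))
      ?_ ?_ ?_ ?_ ?_
    · rintro ⟨f, h⟩ hq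
      simp only [mem_product, FF, mem_filter, mem_univ, true_and] at hq
      simp only [mem_filter, mem_univ, true_and, mem_KK, cnt_fst, cnt_snd]
      exact hq
    · intro p hp
      simp only [mem_filter, mem_univ, true_and, mem_KK, cnt_fst, cnt_snd] at hp
      simp only [mem_product, FF, mem_filter, mem_univ, true_and]
      exact hp
    · intro q _; rfl
    · intro q _; rfl
    · rintro ⟨f, h⟩ _
      by_cases h1 : ∀ t, ((f (g t)) : ℕ) = f t
      · by_cases h2 : ∀ t, ((h (g t)) : ℕ) = h t
        · simp [h1, h2, Prod.ext_iff, Fin.ext_iff]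
        · simp [h1, h2, Prod.ext_iff, Fin.ext_iff]
      · simp only [h1, if_false, zero_mul, Prod.ext_iff, Fin.ext_iff, forall_and, false_and]
  simp only [h1]
  rw [Finset.sum_comm]
  rw [← Finset.sum_fiberwise_of_maps_to (t := KK α β) (g := cnt) (by intro p hp; simpa using hp)]
  rw [Finset.sum_congr rfl (g := fun _ => (Nat.factorial n : ℤ))]
  · simp [mul_comm]
  · intro k hk
    have hs : ∑ c, k c = n := by
      rw [Fintype.sum_prod_type]
      exact (Finset.sum_congr rfl fun i _ => (mem_KK.1 hk).1 i).trans hα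
    rw [← burnside k hs, Nat.cast_sum, Finset.filter_filter]
    apply Finset.sum_congr
    · ext p; simp only [mem_filter, mem_univ, true_and]
      constructor
      · exact fun h => h.2
      · intro h; rw [h]; exact ⟨hk, rfl⟩
    · intro p _
      rw [Finset.sum_boole]
      congr!

noncomputable def expo (a b : Fin n → ℕ) : (Fin n ⊕ Fin n) →₀ ℕ :=
  Finsupp.equivFunOnFinite.symm (Sum.elim a b)

@[simp] lemma expo_inl (a b : Fin n → ℕ) (i) : expo a b (Sum.inl i) = a i := rfl
@[simp] lemma expo_inr (a b : Fin n → ℕ) (i) : expo a b (Sum.inr i) = b i := rfl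

lemma expo_le {a b c d : Fin n → ℕ} : expo a b ≤ expo c d ↔ (∀ i, a i ≤ c i) ∧ ∀ i, b i ≤ d i := by
  constructor
  · intro h; exact ⟨fun i => h (Sum.inl i), fun i => h (Sum.inr i)⟩
  · rintro ⟨h1, h2⟩ (i | i)
    · exact h1 i
    · exact h2 i

lemma expo_sub (a b c d : Fin n → ℕ) : expo c d - expo a b = expo (c - a) (d - b) := by
  ext (i | i) <;> rfl

noncomputable def dd (i j : Fin n) : (Fin n ⊕ Fin n) →₀ ℕ :=
  Finsupp.single (Sum.inl i) 1 + Finsupp.single (Sum.inr j) 1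

lemma dd_ne (i j : Fin n) : dd i j ≠ 0 := by
  intro h
  have := DFunLike.congr_fun h (Sum.inl i)
  simp [dd] at this

noncomputable def xx (i : Fin n) : MvPowerSeries (Fin n ⊕ Fin n) ℤ := MvPowerSeries.X (Sum.inl i)
noncomputable def yy (i : Fin n) : MvPowerSeries (Fin n ⊕ Fin n) ℤ := MvPowerSeries.X (Sum.inr i)

lemma xy_geom (i j : Fin n) : (1 - xx i * yy j) * geom (dd i j) = 1 := by
  have h : xx i * yy j = MvPowerSeries.monomial (dd i j) (1:ℤ) := by
    rw [xx, yy, MvPowerSeries.X, MvPowerSeries.X, MvPowerSeries.monomial_mul_monomial, one_mul]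
    rfl
  rw [h, geom_mul (dd i j) (dd_ne i j)]

lemma coeff_PG (A B : Fin n → ℕ) :
    MvPowerSeries.coeff (expo A B) (∏ i, ∏ j, geom (dd i j)) = ((KK A B).card : ℤ) := by
  rw [← Fintype.prod_prod_type (fun q : Fin n × Fin n => geom (dd q.1 q.2))]
  apply coeff_geom_prod (fun q : Fin n × Fin n => dd q.1 q.2) (fun q => dd_ne _ _)
  intro k
  rw [mem_KK, Finsupp.ext_iff]
  constructor
  · rintro ⟨h1, h2⟩ (i | i)
    · rw [expo_inl, ← h1 i, Finsupp.finsetSum_apply, Fintype.sum_prod_type]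
      simp [dd, Finsupp.single_apply, ← Finset.sum_filter]
    · rw [expo_inr, ← h2 i, Finsupp.finsetSum_apply, Fintype.sum_prod_type]
      simp [dd, Finsupp.single_apply]
  · intro h
    constructor
    · intro i
      rw [← expo_inl A B, ← h, Finsupp.finsetSum_apply, Fintype.sum_prod_type]
      simp [dd, Finsupp.single_apply]
    · intro i
      rw [← expo_inr A B, ← h, Finsupp.finsetSum_apply, Fintype.sum_prod_type]
      simp [dd, Finsupp.single_apply]

lemma prod_xx_yy (a b : Fin n → ℕ) :
    (∏ i, xx i ^ a i) * (∏ i, yy i ^ b i) = MvPowerSeries.monomial (expo a b) (1:ℤ) := by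
  have h : ∀ (s : Fin n ⊕ Fin n) (k : ℕ), (MvPowerSeries.X s : MvPowerSeries (Fin n ⊕ Fin n) ℤ) ^ k =
    MvPowerSeries.monomial (Finsupp.single s k) 1 := fun s k => MvPowerSeries.X_pow_eq s k
  have h2 : MvPowerSeries.monomial (expo a b) (1:ℤ) = ∏ s, MvPowerSeries.X s ^ (expo a b s) := by
    simp only [h]
    rw [MvPowerSeries.prod_monomial]
    simp
  rw [h2, Fintype.prod_sum_type]
  rfl

lemma coeff_lhs (A B : Fin n → ℕ) :
    MvPowerSeries.coeff (expo A B) (aalt (xx (n := n)) * aalt yy * ∏ i, ∏ j, geom (dd i j)) =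
    ∑ w : Equiv.Perm (Fin n), ∑ w' : Equiv.Perm (Fin n),
      (Equiv.Perm.sign w : ℤ) * (Equiv.Perm.sign w' : ℤ) *
      if (∀ i, n - 1 - (w i : ℕ) ≤ A i) ∧ ∀ i, n - 1 - (w' i : ℕ) ≤ B i then
        ((KK (fun i => A i - (n - 1 - (w i : ℕ))) (fun i => B i - (n - 1 - (w' i : ℕ)))).card : ℤ) else 0 := by
  unfold aalt
  rw [Finset.sum_mul_sum, Finset.sum_mul, map_sum]
  refine Finset.sum_congr rfl fun w _ => ?_
  rw [Finset.sum_mul, map_sum]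
  refine Finset.sum_congr rfl fun w' _ => ?_
  rw [mul_mul_mul_comm, prod_xx_yy, ← Int.cast_mul, mul_assoc, ← zsmul_eq_mul, map_zsmul, smul_eq_mul,
    MvPowerSeries.coeff_monomial_mul, expo_sub, one_mul, coeff_PG]
  congr 1
  simp only [expo_le]
  congr

lemma coeff_rhs {A B : Fin n → ℕ} (hA : StrictAnti A) (hB : StrictAnti B) :
    MvPowerSeries.coeff (expo A B) (Matrix.of fun i j : Fin n => geom (dd i j)).det =
      if A = B then 1 else 0 := by
  rw [Matrix.det_apply', map_sum]
  have h : ∀ w : Equiv.Perm (Fin n), MvPowerSeries.coeff (expo A B)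
      (((Equiv.Perm.sign w : ℤ) : MvPowerSeries (Fin n ⊕ Fin n) ℤ) *
        ∏ i, Matrix.of (fun i j : Fin n => geom (dd i j)) (w i) i) =
      (Equiv.Perm.sign w : ℤ) * if A ∘ w = B then 1 else 0 := by
    intro w
    rw [← zsmul_eq_mul, map_zsmul, smul_eq_mul]
    congr 1
    simp only [Matrix.of_apply]
    rw [coeff_geom_prod (fun i => dd (w i) i) (fun i => dd_ne _ _) _ (if A ∘ w = B then {B} else ∅)]
    · split_ifs <;> simp
    · intro k
      have hk : ∑ t, k t • dd (w t) t = expo (k ∘ w.symm) k := by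
        ext (i | i)
        · rw [Finsupp.finsetSum_apply]
          simp [dd, Finsupp.single_apply]
          rw [Finset.sum_eq_single (w.symm i)]
          · simp
          · intro j _ hj
            rw [if_neg]
            intro h; exact hj (by simp [← h])
          · simp
        · rw [Finsupp.finsetSum_apply]
          simp [dd, Finsupp.single_apply]
      rw [hk]
      have : expo (k ∘ w.symm) k = expo A B ↔ k ∘ w.symm = A ∧ k = B := by
        constructor
        · intro h
          exact ⟨funext fun i => DFunLike.congr_fun h (Sum.inl i), funext fun i => DFunLike.congr_fun h (Sum.inr i)⟩
        · rintro ⟨h1, h2⟩; rw [h1, h2]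
      rw [this]
      split_ifs with h
      · simp only [mem_singleton]
        constructor
        · rintro rfl; exact ⟨by rw [← h]; funext i; simp, rfl⟩
        · exact fun h => h.2
      · simp only [notMem_empty, false_iff, not_and]
        rintro h1 rfl
        apply h; rw [← h1]; funext i; simp
  simp only [h]
  rw [Finset.sum_eq_single 1]
  · simp
  · intro w _ hw
    rw [if_neg, mul_zero]
    intro h
    apply hw
    have hm : StrictMono w := by
      intro i j hij
      have := hB hij
      rw [← h] at this
      exact hA.lt_iff_gt.1 this
    ext i
    have := DFunLike.congr_fun (Subsingleton.elim (α := Fin n ≃o Fin n)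
      (hm.orderIsoOfSurjective w w.surjective) (OrderIso.refl _)) i
    exact congrArg Fin.val this
  · simp

lemma sum_parts (l : Partition') (hl : size l = n) : ∑ i : Fin n, l.1 i = n := by
  rw [← Finset.sum_range (fun i => l.1 i)]
  exact (partialSum_eq_size l hl.le).trans hl

lemma part_ext {l m : Partition'} (hl : size l = n) (hm : size m = n) (h : ∀ i : Fin n, l.1 i = m.1 i) :
    l = m := by
  apply Subtype.ext
  ext i
  by_cases hi : i < n
  · exact h ⟨i, hi⟩
  · rw [zero_of_ge_size l (by omega), zero_of_ge_size m (by omega)]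

noncomputable def del (l : Partition') (i : Fin n) : ℕ := l.1 i + (n - 1 - (i : ℕ))

lemma del_anti (l : Partition') : StrictAnti (del (n := n) l) := by
  intro i j h
  unfold del
  have := l.2 h.le
  have := j.2
  have := Fin.lt_def.1 h
  have h3 : l.1 j ≤ l.1 i := l.2 (Fin.le_def.1 h.le)
  omega

theorem irr_ortho (l m : Partition') (hl : size l = n) (hm : size m = n) :
    ∑ g, irrChar n l g * irrChar n m g = if l = m then (Nat.factorial n : ℤ) else 0 := by
  have h1 : ∑ g, irrChar n l g * irrChar n m g = (Nat.factorial n : ℤ) *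
      MvPowerSeries.coeff (expo (del (n := n) l) (del m)) (aalt (xx (n := n)) * aalt yy * ∏ i, ∏ j, geom (dd i j)) := by
    rw [coeff_lhs]
    simp only [irrChar, Finset.sum_mul_sum]
    rw [Finset.sum_comm, Finset.mul_sum]
    refine Finset.sum_congr rfl fun w _ => ?_
    rw [Finset.sum_comm, Finset.mul_sum]
    refine Finset.sum_congr rfl fun w' _ => ?_
    simp only [youngCount_eq]
    simp only [mul_mul_mul_comm, ← Finset.mul_sum]
    rw [mul_left_comm]
    congr 1
    have e : ∀ (l : Partition') (w : Equiv.Perm (Fin n)) (i : Fin n),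
        0 ≤ (l.1 i : ℤ) + ((w i : ℕ) : ℤ) - (i : ℤ) ↔ n - 1 - (w i : ℕ) ≤ del l i := by
      intro l w i; unfold del; have := (w i).2; have := i.2; omega
    have e2 : ∀ (l : Partition') (w : Equiv.Perm (Fin n)) (i : Fin n),
        ((l.1 i : ℤ) + ((w i : ℕ) : ℤ) - (i : ℤ)).toNat = del l i - (n - 1 - (w i : ℕ)) := by
      intro l w i; unfold del; have := (w i).2; have := i.2; omega
    simp only [e]
    by_cases hA : ∀ i, n - 1 - (w i : ℕ) ≤ del l i
    · by_cases hB : ∀ i, n - 1 - (w' i : ℕ) ≤ del m i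
      · rw [if_pos ⟨hA, hB⟩]
        simp only [if_pos hA, if_pos hB]
        rw [yc_inner]
        · simp only [e2]
        · zify
          rw [Finset.sum_congr rfl (fun i _ => Int.toNat_of_nonneg ((e l w i).2 (hA i)))]
          rw [Finset.sum_sub_distrib, Finset.sum_add_distrib,
            Equiv.sum_comp w (fun i => ((i : ℕ) : ℤ))]
          have := sum_parts l hl
          zify at this
          rw [this]; ring
      · rw [if_neg (fun h => hB h.2)]
        simp only [if_neg hB, mul_zero, Finset.sum_const_zero]
    · rw [if_neg (fun h => hA h.1)]
      simp only [if_neg hA, zero_mul, mul_zero, Finset.sum_const_zero]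
  rw [h1, aalt_mul xx yy (fun i j => geom (dd i j)) xy_geom, coeff_rhs (del_anti l) (del_anti m)]
  have : del (n := n) l = del m ↔ l = m := by
    constructor
    · intro h
      apply part_ext hl hm
      intro i
      have := congrFun h i
      unfold del at this
      omega
    · rintro rfl; rfl
  rw [if_congr this rfl rfl]
  simp

end ortho
end HD

namespace HD
open Finset Partition'

section real
variable {n : ℕ}
local notation "𝔸" n => MonoidAlgebra ℂ (Equiv.Perm (Fin n))

def RealC (u : 𝔸 n) : Prop := ∀ σ, (starRingEnd ℂ) (u.coeff σ) = u.coeff σ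

lemma RealC.mul {u v : 𝔸 n} (hu : RealC u) (hv : RealC v) : RealC (u * v) := by
  have h : ∀ y, (u * v).coeff y = ∑ σ, u.coeff σ * v.coeff (σ⁻¹ * y) := by
    intro y
    have : (u * v).coeff y = (u * (v * gg y⁻¹)).coeff 1 := by
      rw [← mul_assoc, mul_gg_apply]; simp
    rw [this, mul_apply_one]
    simp [mul_gg_apply]
  intro y
  rw [h, map_sum]
  refine Finset.sum_congr rfl fun σ _ => ?_
  rw [map_mul, hu, hv]

lemma real_stab {κ : Type*} (f : Fin n → κ) : RealC (stabSum f) := by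
  intro σ; rw [stab_apply]; split_ifs <;> simp

lemma real_alt {κ : Type*} (f : Fin n → κ) : RealC (altSum f) := by
  intro σ; rw [alt_apply]; split_ifs <;> simp

lemma chi_real (row col : Fin n → ℕ) (σ) : (starRingEnd ℂ) (chi row col σ) = chi row col σ := by
  unfold chi hh kap
  have h1 := (real_stab row).mul (real_alt col)
  have h2 := (real_alt col).mul (real_stab row)
  simp only [map_mul, map_inv₀, map_sum]
  simp only [h1 _, h2 _]

theorem irr_eq_chi (l : Partition') (hl : size l = n) (σ : Equiv.Perm (Fin n)) :
    (irrChar n l σ : ℂ) = chiP n l σ := by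
  have h1 := chi_norm (tab l hl)
  have h2 := chi_irr l hl
  have h3 : ∑ g : Equiv.Perm (Fin n), (irrChar n l g : ℂ) * (irrChar n l g : ℂ) = (Nat.factorial n : ℂ) := by
    have := irr_ortho l l hl hl
    rw [if_pos rfl] at this
    exact_mod_cast congrArg (Int.cast : ℤ → ℂ) this
  have h4 : ∑ g : Equiv.Perm (Fin n), (chiP n l g - irrChar n l g) * (chiP n l g - irrChar n l g) = 0 := by
    have : ∀ g : Equiv.Perm (Fin n), (chiP n l g - irrChar n l g) * (chiP n l g - irrChar n l g) =
      chiP n l g * chiP n l g - 2 * (chiP n l g * irrChar n l g) + (irrChar n l g : ℂ) * (irrChar n l g : ℂ) := by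
      intro g; ring
    simp only [this, Finset.sum_add_distrib, Finset.sum_sub_distrib, ← Finset.mul_sum]
    rw [h1, h2, h3]; ring
  have h5 : ∀ g : Equiv.Perm (Fin n), (chiP n l g - irrChar n l g) * (chiP n l g - irrChar n l g) =
      (Complex.normSq (chiP n l g - irrChar n l g) : ℂ) := by
    intro g
    rw [← Complex.mul_conj, map_sub, chi_real]
    simp
  simp only [h5] at h4
  have h6 : ∑ g : Equiv.Perm (Fin n), Complex.normSq (chiP n l g - irrChar n l g) = 0 := by
    exact_mod_cast h4
  rw [Finset.sum_eq_zero_iff_of_nonneg (fun g _ => Complex.normSq_nonneg _)] at h6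
  have := Complex.normSq_eq_zero.1 (h6 σ (mem_univ σ))
  exact (sub_eq_zero.1 this).symm
end real

section complete
variable {n : ℕ}

abbrev PP (n : ℕ) := {l : Partition' // size l = n}

lemma part_le (l : Partition') (i : ℕ) : l.1 i ≤ size l := by
  have := partialSum_le_size l (i + 1)
  rw [partialSum_succ] at this
  omega

instance : Finite (PP n) := by
  apply Finite.of_injective (fun (l : PP n) (i : Fin n) => (⟨l.1.1 i, by
    have := part_le l.1 i; rw [l.2] at this; omega⟩ : Fin (n + 1)))
  intro l m h
  apply Subtype.ext
  apply part_ext l.2 m.2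
  intro i
  have := congrFun h i
  simpa using this

noncomputable instance : Fintype (PP n) := Fintype.ofFinite _

lemma mul_count (s : Multiset ℕ) (hs : ∀ p ∈ s, p ≤ n) :
    ∑ i ∈ range n, (s.filter (fun p => i < p)).card = s.sum := by
  induction s using Multiset.induction_on with
  | empty => simp
  | cons a s ih =>
    have ih := ih (fun p hp => hs p (Multiset.mem_cons_of_mem hp))
    simp only [Multiset.filter_cons, Multiset.card_add, Finset.sum_add_distrib, ih, Multiset.sum_cons]
    congr 1
    have ha : a ≤ n := hs a (Multiset.mem_cons_self a s)
    have : ∀ i, (if i < a then ({a} : Multiset ℕ) else 0).card = if i < a then 1 else 0 := by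
      intro i; split_ifs <;> simp
    simp only [this, Finset.sum_boole]
    have : (range n).filter (fun i => i < a) = range a := by ext i; simp; omega
    simp [this]

lemma part_le_n (p : n.Partition) {a : ℕ} (ha : a ∈ p.parts) : a ≤ n := by
  have := Multiset.le_sum_of_mem ha
  rwa [p.parts_sum] at this

noncomputable def conjF (p : n.Partition) : ℕ →₀ ℕ :=
  Finsupp.onFinset (range n) (fun i => (p.parts.filter (fun a => i < a)).card) (by
    intro i hi
    rw [mem_range]
    by_contra hc
    apply hi
    rw [Multiset.card_eq_zero, Multiset.filter_eq_nil]
    intro a ha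
    have := part_le_n p ha
    omega)

noncomputable def conjP (p : n.Partition) : PP n := ⟨⟨conjF p, by
  intro i j hij
  apply Multiset.card_le_card
  apply Multiset.monotone_filter_right
  intro a h
  exact lt_of_le_of_lt hij h⟩, by
  show (conjF p).sum _ = n
  unfold conjF
  rw [Finsupp.sum_of_support_subset _ (Finsupp.support_onFinset_subset) _ (by simp)]
  simp only [Finsupp.onFinset_apply]
  rw [mul_count _ (fun a => part_le_n p), p.parts_sum]⟩

lemma count_eq (s : Multiset ℕ) (a : ℕ) :
    (s.filter (fun p => a < p)).card = (s.filter (fun p => a + 1 < p)).card + s.count (a + 1) := by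
  induction s using Multiset.induction_on with
  | empty => simp
  | cons b s ih =>
    simp only [Multiset.filter_cons, Multiset.card_add, ih, Multiset.count_cons]
    split_ifs <;> simp <;> omega

lemma conjP_inj : Function.Injective (conjP (n := n)) := by
  intro p q h
  have h1 : ∀ i, (p.parts.filter (fun a => i < a)).card = (q.parts.filter (fun a => i < a)).card :=
    fun i => DFunLike.congr_fun (congrArg (fun l : PP n => l.1.1) h) i
  ext a
  cases a with
  | zero =>
    rw [Multiset.count_eq_zero_of_notMem, Multiset.count_eq_zero_of_notMem]
    · intro h; exact absurd (q.parts_pos h) (lt_irrefl _)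
    · intro h; exact absurd (p.parts_pos h) (lt_irrefl _)
  | succ a =>
    have e1 := count_eq p.parts a
    have e2 := count_eq q.parts a
    rw [h1 a, h1 (a + 1)] at e1
    omega

noncomputable def castPart {m n : ℕ} (h : m = n) (p : m.Partition) : n.Partition := h ▸ p

lemma castPart_inj {m n : ℕ} (h : m = n) : Function.Injective (castPart h) := by
  subst h; exact fun _ _ h => h

noncomputable def typ (σ : Equiv.Perm (Fin n)) : PP n :=
  conjP (castPart (Fintype.card_fin n) σ.partition)

lemma typ_conj {σ τ : Equiv.Perm (Fin n)} (h : typ σ = typ τ) : IsConj σ τ :=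
  Equiv.Perm.partition_eq_of_isConj.2 (castPart_inj _ (conjP_inj h))

def CF (n : ℕ) : Submodule ℂ (Equiv.Perm (Fin n) → ℂ) where
  carrier := {φ | IsClass φ}
  add_mem' := by intro a b ha hb x σ; simp [ha x σ, hb x σ]
  zero_mem' := by intro x σ; rfl
  smul_mem' := by intro c a ha x σ; simp [ha x σ]

noncomputable def cfMap (n : ℕ) : CF n →ₗ[ℂ] (PP n → ℂ) where
  toFun φ := fun l => if h : ∃ σ : Equiv.Perm (Fin n), typ σ = l then φ.1 h.choose else 0
  map_add' := by intro a b; funext l; dsimp; split_ifs <;> simp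
  map_smul' := by intro a b; funext l; dsimp; split_ifs <;> simp

lemma cfMap_inj (n : ℕ) : Function.Injective (cfMap n) := by
  intro φ ψ h
  apply Subtype.ext
  funext σ
  have h1 := congrFun h (typ σ)
  have hex : ∃ σ' : Equiv.Perm (Fin n), typ σ' = typ σ := ⟨σ, rfl⟩
  simp only [cfMap, LinearMap.coe_mk, AddHom.coe_mk] at h1
  rw [dif_pos hex, dif_pos hex] at h1
  obtain ⟨x, hx⟩ := isConj_iff.1 (typ_conj hex.choose_spec)
  have a := φ.2 x hex.choose
  have b := ψ.2 x hex.choose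
  rw [hx] at a b
  rw [a, b, h1]

noncomputable def irrCF (l : PP n) : CF n := ⟨fun g => (irrChar n l.1 g : ℂ), irrChar_class l.1⟩

lemma irr_orthoC (l m : PP n) : ∑ g : Equiv.Perm (Fin n), (irrChar n l.1 g : ℂ) * irrChar n m.1 g =
    if l = m then (Nat.factorial n : ℂ) else 0 := by
  have := irr_ortho l.1 m.1 l.2 m.2
  have h2 := congrArg (Int.cast : ℤ → ℂ) this
  push_cast at h2
  rw [h2]
  simp [Subtype.ext_iff]

lemma fac_ne (n : ℕ) : (Nat.factorial n : ℂ) ≠ 0 := by exact_mod_cast Nat.factorial_ne_zero n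

lemma coef_of_sum (a : PP n → ℂ) (m : PP n) :
    ∑ g : Equiv.Perm (Fin n), (∑ l, a l * (irrChar n l.1 g : ℂ)) * irrChar n m.1 g = Nat.factorial n * a m := by
  simp only [Finset.sum_mul]
  rw [Finset.sum_comm]
  simp only [mul_assoc, ← Finset.mul_sum, irr_orthoC]
  simp [mul_comm]

lemma irrCF_li : LinearIndependent ℂ (irrCF (n := n)) := by
  rw [Fintype.linearIndependent_iff]
  intro a h m
  have h1 : ∀ g : Equiv.Perm (Fin n), ∑ l, a l * (irrChar n l.1 g : ℂ) = 0 := by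
    intro g
    have := congrFun (congrArg Subtype.val h) g
    simpa [irrCF] using this
  have h2 := coef_of_sum a m
  simp only [h1, zero_mul, Finset.sum_const_zero] at h2
  have := fac_ne n
  have h3 := mul_eq_zero.1 h2.symm
  tauto

theorem complete {φ : Equiv.Perm (Fin n) → ℂ} (hφ : IsClass φ) (σ : Equiv.Perm (Fin n)) :
    φ σ = ∑ l : PP n, ((Nat.factorial n : ℂ)⁻¹ * ∑ g, φ g * irrChar n l.1 g) * irrChar n l.1 σ := by
  have hle : Module.finrank ℂ (CF n) ≤ Fintype.card (PP n) := by
    have := LinearMap.finrank_le_finrank_of_injective (cfMap_inj n)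
    simpa using this
  have hcard : Fintype.card (PP n) = Module.finrank ℂ (CF n) :=
    le_antisymm irrCF_li.fintype_card_le_finrank hle
  have hspan := irrCF_li.span_eq_top_of_card_eq_finrank' hcard
  have hm : (⟨φ, hφ⟩ : CF n) ∈ Submodule.span ℂ (Set.range (irrCF (n := n))) := by rw [hspan]; trivial
  obtain ⟨a, ha⟩ := (Submodule.mem_span_range_iff_exists_fun ℂ).1 hm
  have h1 : ∀ g, φ g = ∑ l, a l * (irrChar n l.1 g : ℂ) := by
    intro g
    have := congrFun (congrArg Subtype.val ha) g
    rw [← show _ = φ g from this]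
    simp [irrCF]
  have h2 : ∀ l : PP n, (Nat.factorial n : ℂ)⁻¹ * ∑ g, φ g * irrChar n l.1 g = a l := by
    intro l
    simp only [h1]
    rw [coef_of_sum, inv_mul_cancel_left₀ (fac_ne n)]
  simp only [h2]
  exact h1 σ

end complete
end HD

namespace HD
open Finset Partition'

section traceRange
variable {V : Type*} [AddCommGroup V] [Module ℂ V] [FiniteDimensional ℂ V]

lemma range_inv {E T : V →ₗ[ℂ] V} (hT : T ∘ₗ E = E ∘ₗ T) : ∀ x ∈ LinearMap.range E, T x ∈ LinearMap.range E := by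
  rintro x ⟨v, rfl⟩
  exact ⟨T v, (LinearMap.congr_fun hT v).symm⟩

lemma trace_range (E T : V →ₗ[ℂ] V) (h : ℂ) (h0 : h ≠ 0) (hE : E ∘ₗ E = h • E)
    (hT : T ∘ₗ E = E ∘ₗ T) (hi : ∀ x ∈ LinearMap.range E, T x ∈ LinearMap.range E) :
    LinearMap.trace ℂ _ (T.restrict hi) = h⁻¹ * LinearMap.trace ℂ V (T ∘ₗ E) := by
  have e1 : T ∘ₗ E = (T ∘ₗ (LinearMap.range E).subtype) ∘ₗ E.rangeRestrict := by
    ext v; rfl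
  have e2 : E.rangeRestrict ∘ₗ (T ∘ₗ (LinearMap.range E).subtype) = h • T.restrict hi := by
    ext ⟨r, v, rfl⟩
    have a := LinearMap.congr_fun hT (E v)
    have b := LinearMap.congr_fun hE v
    simp only [LinearMap.comp_apply, LinearMap.smul_apply] at a b
    simp only [LinearMap.comp_apply, Submodule.subtype_apply, LinearMap.codRestrict_apply,
      LinearMap.smul_apply, Submodule.coe_smul, LinearMap.restrict_coe_apply, LinearMap.rangeRestrict]
    rw [← a, b, map_smul]
  rw [e1, LinearMap.trace_comp_comm', e2, map_smul, smul_eq_mul, inv_mul_cancel_left₀ h0]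

end traceRange

section integrality

def IsChar {G : Type} [Group G] (χ : G → ℂ) : Prop :=
  ∃ (V : Type) (_ : AddCommGroup V) (_ : Module ℂ V) (_ : FiniteDimensional ℂ V)
    (ρ : Representation ℂ G V), ∀ g, LinearMap.trace ℂ V (ρ g) = χ g

lemma IsChar.mul {G : Type} [Group G] {χ ψ : G → ℂ} (h1 : IsChar χ) (h2 : IsChar ψ) :
    IsChar (fun g => χ g * ψ g) := by
  obtain ⟨V, i1, i2, i3, ρ, hρ⟩ := h1
  obtain ⟨W, j1, j2, j3, σ, hσ⟩ := h2
  refine ⟨V ⊗[ℂ] W, inferInstance, inferInstance, inferInstance, ρ.tprod σ, fun g => ?_⟩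
  show _ = χ g * ψ g
  rw [← hρ, ← hσ]
  exact LinearMap.trace_tensorProduct' (ρ g) (σ g)

lemma IsChar.comp {G H : Type} [Group G] [Group H] {χ : G → ℂ} (h1 : IsChar χ) (f : H →* G) :
    IsChar (fun g => χ (f g)) := by
  obtain ⟨V, i1, i2, i3, ρ, hρ⟩ := h1
  exact ⟨V, i1, i2, i3, MonoidHom.comp ρ f, fun g => hρ (f g)⟩

lemma IsChar.avg {G : Type} [Group G] [Fintype G] {χ : G → ℂ} (h1 : IsChar χ) :
    ∃ N : ℕ, ∑ g, χ g = (Fintype.card G : ℂ) * N := by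
  obtain ⟨V, i1, i2, i3, ρ, hρ⟩ := h1
  have h0 : (Fintype.card G : ℂ) ≠ 0 := by exact_mod_cast Fintype.card_ne_zero
  letI : Invertible (Fintype.card G : ℂ) := invertibleOfNonzero h0
  letI : Invertible (Nat.card G : ℂ) := by rw [Nat.card_eq_fintype_card]; infer_instance
  have := ρ.card_inv_mul_sum_char_eq_finrank
  refine ⟨Module.finrank ℂ ρ.invariants, ?_⟩
  rw [← this]
  simp only [Representation.character, hρ, Nat.card_eq_fintype_card]
  simp

variable {n : ℕ}

lemma irr_isChar (l : PP n) : IsChar (fun g : Equiv.Perm (Fin n) => (irrChar n l.1 g : ℂ)) := by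
  obtain ⟨l, hl⟩ := l
  set c : MonoidAlgebra ℂ (Equiv.Perm (Fin n)) :=
    altSum (fun t : Fin n => colOf l t) * stabSum (fun t : Fin n => rowOf l t) with hc
  let E := LinearMap.mulRight ℂ c
  have hT : ∀ g : Equiv.Perm (Fin n), (LinearMap.mulLeft ℂ (gg g)) ∘ₗ E = E ∘ₗ (LinearMap.mulLeft ℂ (gg g)) := by
    intro g; ext x; simp [E, mul_assoc]
  let ρ : Representation ℂ (Equiv.Perm (Fin n)) (LinearMap.range E) :=
    { toFun := fun g => (LinearMap.mulLeft ℂ (gg g)).restrict (range_inv (hT g))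
      map_one' := by ext x; simp [LinearMap.restrict_apply, gg_one]
      map_mul' := by intro g h; ext x; simp [LinearMap.restrict_apply, gg_mul] }
  haveI : FiniteDimensional ℂ (MonoidAlgebra ℂ (Equiv.Perm (Fin n))) :=
    Module.Basis.finiteDimensional_of_finite (gaBasis n)
  refine ⟨LinearMap.range E, inferInstance, inferInstance, inferInstance, ρ, fun g => ?_⟩
  have hE : E ∘ₗ E = hh (fun t : Fin n => rowOf l t) (fun t : Fin n => colOf l t) • E := by
    apply LinearMap.ext
    intro x
    have := c_sq (tab l hl)
    rw [← hc] at this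
    simp [E, mul_assoc, this]
  have := trace_range E (LinearMap.mulLeft ℂ (gg g)) _ (hh_ne_zero (tab l hl)) hE (hT g) (range_inv (hT g))
  rw [show ρ g = (LinearMap.mulLeft ℂ (gg g)).restrict (range_inv (hT g)) from rfl, this, trace_LR]
  show _ = (irrChar n l g : ℂ)
  rw [irr_eq_chi l hl]
  exact (chi_class (fun t : Fin n => rowOf l t) (fun t : Fin n => colOf l t)).inv g

lemma toNat_aux {S : ℤ} {d N : ℕ} (hd : d ≠ 0) (h : (S : ℂ) = (d : ℂ) * N) :
    (((S / (d : ℤ)).toNat : ℕ) : ℂ) = (d : ℂ)⁻¹ * S := by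
  have h1 : S = (d : ℤ) * N := by exact_mod_cast h
  have hd' : (d : ℂ) ≠ 0 := by exact_mod_cast hd
  rw [h, inv_mul_cancel_left₀ hd', h1, Int.mul_ediv_cancel_left _ (by exact_mod_cast hd)]
  simp

theorem kron_eq (l m nu : PP n) : (kron l.1 m.1 nu.1 : ℂ) =
    (Nat.factorial n : ℂ)⁻¹ * ∑ g : Equiv.Perm (Fin n),
      (irrChar n l.1 g : ℂ) * irrChar n m.1 g * irrChar n nu.1 g := by
  obtain ⟨N, hN⟩ := (((irr_isChar l).mul (irr_isChar m)).mul (irr_isChar nu)).avg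
  obtain ⟨nu, rfl⟩ := nu
  unfold kron
  rw [if_pos ⟨l.2, m.2⟩]
  have := toNat_aux (S := ∑ g : Equiv.Perm (Fin (size nu)),
    irrChar _ l.1 g * irrChar _ m.1 g * irrChar _ nu g) (N := N)
    (Nat.factorial_ne_zero (size nu)) (by
      push_cast; rw [hN, Fintype.card_perm, Fintype.card_fin])
  rw [this]
  push_cast
  rfl

lemma sumEmb_mul {a b : ℕ} (g g' : Equiv.Perm (Fin a)) (h h' : Equiv.Perm (Fin b)) :
    sumEmb (g * g') (h * h') = sumEmb g h * sumEmb g' h' := by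
  unfold sumEmb
  ext t
  obtain ⟨s, rfl⟩ := finSumFinEquiv.surjective t
  rcases s with s | s <;> simp [Equiv.permCongr_apply]

noncomputable def sumHom (a b : ℕ) : Equiv.Perm (Fin a) × Equiv.Perm (Fin b) →* Equiv.Perm (Fin (a + b)) :=
  MonoidHom.mk' (fun p => sumEmb p.1 p.2) (fun p q => sumEmb_mul _ _ _ _)

theorem lr_eq {a b : ℕ} (l : PP a) (m : PP b) (nu : PP (a + b)) : (lr l.1 m.1 nu.1 : ℂ) =
    ((Nat.factorial a : ℂ) * (Nat.factorial b : ℂ))⁻¹ *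
      ∑ g : Equiv.Perm (Fin a), ∑ h : Equiv.Perm (Fin b),
      (irrChar a l.1 g : ℂ) * irrChar b m.1 h * irrChar (a + b) nu.1 (sumEmb g h) := by
  obtain ⟨N, hN⟩ := ((((irr_isChar l).comp (MonoidHom.fst _ _)).mul
    ((irr_isChar m).comp (MonoidHom.snd _ _))).mul ((irr_isChar nu).comp (sumHom a b))).avg
  obtain ⟨l, rfl⟩ := l
  obtain ⟨m, rfl⟩ := m
  unfold lr
  rw [if_pos nu.2]
  rw [Fintype.sum_prod_type, Fintype.card_prod] at hN
  simp only [Fintype.card_perm, Fintype.card_fin] at hN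
  have := toNat_aux (S := ∑ g : Equiv.Perm (Fin (size l)), ∑ h : Equiv.Perm (Fin (size m)),
      irrChar (size l) l g * irrChar _ m h * irrChar _ nu.1 (sumEmb g h)) (N := N)
    (mul_ne_zero (Nat.factorial_ne_zero (size l)) (Nat.factorial_ne_zero (size m))) (by
      push_cast; rw [Nat.cast_mul] at hN; exact hN)
  rw [Nat.cast_mul] at this
  rw [this]
  push_cast
  rfl

end integrality
end HD

namespace HD
open Finset Partition'

section mats
variable {n : ℕ} {I J : Type*} [Fintype I] [Fintype J]

noncomputable def Pm (A : Matrix I I ℂ) (σ : Equiv.Perm (Fin n)) : ℂ :=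
  ∑ f : Fin n → I, ∏ t, A (f (σ t)) (f t)

lemma Pm_class (A : Matrix I I ℂ) : IsClass (Pm (n := n) A) := by
  intro x σ
  unfold Pm
  rw [← Equiv.sum_comp (Equiv.arrowCongr x (Equiv.refl I))]
  refine Finset.sum_congr rfl fun f _ => ?_
  rw [← Equiv.prod_comp x]
  simp

noncomputable def SS (n : ℕ) (l : Partition') (A : Matrix I I ℂ) : ℂ :=
  (Nat.factorial n : ℂ)⁻¹ * ∑ σ : Equiv.Perm (Fin n), Pm A σ * irrChar n l σ

lemma Pm_expand (A : Matrix I I ℂ) (σ : Equiv.Perm (Fin n)) :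
    Pm A σ = ∑ l : PP n, SS n l.1 A * irrChar n l.1 σ := complete (Pm_class A) σ

lemma Pm_sumEmb {a b : ℕ} (A : Matrix I I ℂ) (g : Equiv.Perm (Fin a)) (h : Equiv.Perm (Fin b)) :
    Pm A (sumEmb g h) = Pm A g * Pm A h := by
  unfold Pm
  rw [Finset.sum_mul_sum, ← Fintype.sum_prod_type',
    ← Equiv.sum_comp (Fin.appendEquiv a b)]
  refine Finset.sum_congr rfl fun f _ => ?_
  rw [Fin.prod_univ_add]
  congr 1 <;>
  · refine Finset.prod_congr rfl fun t _ => ?_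
    simp [sumEmb, Equiv.permCongr_apply, Fin.appendEquiv]

theorem SS_mul {a b : ℕ} (A : Matrix I I ℂ) (l : PP a) (m : PP b) :
    SS a l.1 A * SS b m.1 A = ∑ nu : PP (a + b), (lr l.1 m.1 nu.1 : ℂ) * SS (a + b) nu.1 A := by
  simp only [lr_eq]
  unfold SS
  rw [mul_mul_mul_comm, ← mul_inv, Finset.sum_mul_sum]
  have h : ∀ (g : Equiv.Perm (Fin a)) (h : Equiv.Perm (Fin b)),
      Pm A g * irrChar a l.1 g * (Pm A h * irrChar b m.1 h) =
      ∑ nu : PP (a + b), (irrChar a l.1 g : ℂ) * irrChar b m.1 h * irrChar (a + b) nu.1 (sumEmb g h) *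
        SS (a + b) nu.1 A := by
    intro g h
    rw [mul_mul_mul_comm, ← Pm_sumEmb, Pm_expand, Finset.sum_mul]
    refine Finset.sum_congr rfl fun nu _ => ?_
    ring
  simp only [h]
  have h2 : ∑ g : Equiv.Perm (Fin a), ∑ h : Equiv.Perm (Fin b), ∑ nu : PP (a + b),
      (irrChar a l.1 g : ℂ) * irrChar b m.1 h * irrChar (a + b) nu.1 (sumEmb g h) *
        SS (a + b) nu.1 A = ∑ nu : PP (a + b), (∑ g : Equiv.Perm (Fin a), ∑ h : Equiv.Perm (Fin b),
      (irrChar a l.1 g : ℂ) * irrChar b m.1 h * irrChar (a + b) nu.1 (sumEmb g h)) *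
        SS (a + b) nu.1 A := by
    simp only [Finset.sum_mul]
    rw [Finset.sum_comm]
    conv_rhs => rw [Finset.sum_comm]
    rw [Finset.sum_comm]
    refine Finset.sum_congr rfl fun g _ => ?_
    rw [Finset.sum_comm]
  rw [h2, Finset.mul_sum]
  refine Finset.sum_congr rfl fun nu _ => ?_
  rw [mul_assoc]
  rfl

lemma Pm_kron (A : Matrix I I ℂ) (B : Matrix J J ℂ) (σ : Equiv.Perm (Fin n)) :
    Pm (Matrix.kroneckerMap (· * ·) A B) σ = Pm A σ * Pm B σ := by
  unfold Pm
  rw [Finset.sum_mul_sum, ← Fintype.sum_prod_type', ← Equiv.sum_comp (Equiv.arrowProdEquivProdArrow _ _ _)]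
  refine Finset.sum_congr rfl fun f _ => ?_
  simp [Equiv.arrowProdEquivProdArrow, ← Finset.prod_mul_distrib, Matrix.kroneckerMap_apply]

theorem SS_kron (A : Matrix I I ℂ) (B : Matrix J J ℂ) (d : PP n) :
    SS n d.1 (Matrix.kroneckerMap (· * ·) A B) =
      ∑ b : PP n, ∑ e : PP n, (kron b.1 e.1 d.1 : ℂ) * (SS n b.1 A * SS n e.1 B) := by
  simp only [kron_eq]
  conv_lhs => unfold SS
  have h : ∀ g : Equiv.Perm (Fin n), Pm (Matrix.kroneckerMap (· * ·) A B) g * irrChar n d.1 g =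
      ∑ b : PP n, ∑ e : PP n, (irrChar n b.1 g : ℂ) * irrChar n e.1 g * irrChar n d.1 g *
        (SS n b.1 A * SS n e.1 B) := by
    intro g
    rw [Pm_kron, Pm_expand, Pm_expand, Finset.sum_mul_sum, Finset.sum_mul]
    refine Finset.sum_congr rfl fun b _ => ?_
    rw [Finset.sum_mul]
    refine Finset.sum_congr rfl fun e _ => ?_
    ring
  simp only [h]
  rw [Finset.sum_comm, Finset.mul_sum]
  refine Finset.sum_congr rfl fun b _ => ?_
  rw [Finset.sum_comm, Finset.mul_sum]
  refine Finset.sum_congr rfl fun e _ => ?_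
  rw [mul_assoc, Finset.sum_mul]

lemma SS_submatrix (l : Partition') (A : Matrix I I ℂ) (e : J ≃ I) :
    SS n l (A.submatrix e e) = SS n l A := by
  unfold SS
  congr 1
  refine Finset.sum_congr rfl fun σ _ => ?_
  congr 1
  unfold Pm
  rw [← Equiv.sum_comp (Equiv.arrowCongr (Equiv.refl (Fin n)) e)]
  refine Finset.sum_congr rfl fun f _ => ?_
  simp

end mats
end HD

namespace HD
open Finset Partition'

section blocks
variable {n : ℕ} {I J : Type*} [Fintype I] [Fintype J]

def lset (f : Fin n → I ⊕ J) : Finset (Fin n) := univ.filter (fun t => (f t).isLeft = true)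

noncomputable def Wt (φ : Equiv.Perm (Fin n) → ℂ) (M : Matrix (I ⊕ J) (I ⊕ J) ℂ) (f : Fin n → I ⊕ J) : ℂ :=
  ∑ σ : Equiv.Perm (Fin n), φ σ * ∏ t, M (f (σ t)) (f t)

lemma Wt_conj {φ : Equiv.Perm (Fin n) → ℂ} (hφ : IsClass φ) (M : Matrix (I ⊕ J) (I ⊕ J) ℂ)
    (F : Fin n → I ⊕ J) (x : Equiv.Perm (Fin n)) : Wt φ M (F ∘ x.symm) = Wt φ M F := by
  unfold Wt
  rw [← Equiv.sum_comp (MulAut.conj x).toEquiv]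
  refine Finset.sum_congr rfl fun σ _ => ?_
  have : φ ((MulAut.conj x).toEquiv σ) = φ σ := hφ x σ
  rw [this]
  congr 1
  rw [← Equiv.prod_comp x]
  refine Finset.prod_congr rfl fun t _ => ?_
  simp [MulAut.conj_apply]

noncomputable def app {a b : ℕ} (p : (Fin a → I) × (Fin b → J)) : Fin (a + b) → I ⊕ J :=
  Fin.append (Sum.inl ∘ p.1) (Sum.inr ∘ p.2)

lemma sumEmb_inj {a b : ℕ} {p q : Equiv.Perm (Fin a) × Equiv.Perm (Fin b)}
    (h : sumEmb p.1 p.2 = sumEmb q.1 q.2) : p = q := by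
  unfold sumEmb at h
  have h2 := (Equiv.permCongr finSumFinEquiv).injective h
  exact Equiv.Perm.sumCongrHom_injective (a₁ := p) (a₂ := q) h2

lemma Wt_app {a b : ℕ} (φ : Equiv.Perm (Fin (a + b)) → ℂ) (A : Matrix I I ℂ) (B : Matrix J J ℂ)
    (p : (Fin a → I) × (Fin b → J)) :
    Wt φ (Matrix.fromBlocks A 0 0 B) (app p) =
    ∑ q : Equiv.Perm (Fin a) × Equiv.Perm (Fin b), φ (sumEmb q.1 q.2) *
      ((∏ t, A (p.1 (q.1 t)) (p.1 t)) * ∏ t, B (p.2 (q.2 t)) (p.2 t)) := by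
  unfold Wt
  symm
  have key : ∀ q : Equiv.Perm (Fin a) × Equiv.Perm (Fin b),
      (∏ t, A (p.1 (q.1 t)) (p.1 t)) * ∏ t, B (p.2 (q.2 t)) (p.2 t) =
      ∏ t, (Matrix.fromBlocks A 0 0 B) (app p (sumEmb q.1 q.2 t)) (app p t) := by
    intro q
    rw [Fin.prod_univ_add]
    congr 1 <;>
    · refine Finset.prod_congr rfl fun t _ => ?_
      simp [sumEmb, Equiv.permCongr_apply, app]
  simp only [key]
  refine Finset.sum_of_injOn (fun q => sumEmb q.1 q.2) ?_ ?_ ?_ ?_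
  · intro q _ q' _ h
    exact sumEmb_inj h
  · intro q _; simp
  · intro σ _ hσ
    rw [mul_eq_zero]; right
    by_contra hne
    replace hne := Finset.prod_ne_zero_iff.1 hne
    apply hσ
    have hmap : Set.MapsTo ((Equiv.permCongr finSumFinEquiv).symm σ)
        (Set.range (Sum.inl : Fin a → Fin a ⊕ Fin b)) (Set.range (Sum.inl : Fin a → Fin a ⊕ Fin b)) := by
      rintro _ ⟨i, rfl⟩
      have := hne (Fin.castAdd b i) (mem_univ _)
      rcases h : finSumFinEquiv.symm (σ (Fin.castAdd b i)) with j | j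
      · exact ⟨j, by simp [← h, Equiv.permCongr]⟩
      · exfalso
        rw [Equiv.symm_apply_eq] at h
        rw [h] at this
        simp [app] at this
    obtain ⟨q, hq⟩ := Equiv.Perm.mem_sumCongrHom_range_of_perm_mapsTo_inl hmap
    refine ⟨q, by simp, ?_⟩
    show sumEmb q.1 q.2 = σ
    unfold sumEmb
    rw [← Equiv.eq_symm_apply, ← hq]
    rfl
  · intro q _; rfl

lemma exists_x {a b : ℕ} (T : Finset (Fin (a + b))) (hT : T.card = a) :
    ∃ x : Equiv.Perm (Fin (a + b)), ∀ i, x i ∈ T ↔ (i : ℕ) < a := by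
  have hc : Fintype.card {i : Fin (a+b) // (i : ℕ) < a} = Fintype.card {i : Fin (a + b) // i ∈ T} := by
    rw [Fintype.card_coe, hT]
    suffices hb : Function.Bijective (fun i : Fin a => (⟨Fin.castAdd b i, i.2⟩ : {i : Fin (a+b) // (i : ℕ) < a})) by
      rw [← Fintype.card_of_bijective hb, Fintype.card_fin]
    constructor
    · intro i j h
      simpa using h
    · rintro ⟨i, hi⟩
      exact ⟨⟨i, hi⟩, rfl⟩
  obtain ⟨e⟩ := Fintype.card_eq.1 hc
  refine ⟨e.extendSubtype, fun i => ?_⟩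
  by_cases hi : (i : ℕ) < a
  · simp only [hi, iff_true]
    exact e.extendSubtype_mem i hi
  · simp only [hi, iff_false]
    exact e.extendSubtype_not_mem i hi

lemma sum_lset {a b : ℕ} (φ : Equiv.Perm (Fin (a + b)) → ℂ) (hφ : IsClass φ) (A : Matrix I I ℂ) (B : Matrix J J ℂ)
    (T : Finset (Fin (a + b))) (hT : T.card = a) :
    ∑ f ∈ univ.filter (fun f : Fin (a + b) → I ⊕ J => lset f = T), Wt φ (Matrix.fromBlocks A 0 0 B) f =
    ∑ g : Equiv.Perm (Fin a), ∑ h : Equiv.Perm (Fin b), φ (sumEmb g h) * (Pm A g * Pm B h) := by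
  obtain ⟨x, hx⟩ := exists_x T hT
  have e1 : ∑ f ∈ univ.filter (fun f : Fin (a + b) → I ⊕ J => lset f = T), Wt φ (Matrix.fromBlocks A 0 0 B) f =
      ∑ p : (Fin a → I) × (Fin b → J), Wt φ (Matrix.fromBlocks A 0 0 B) (app p) := by
    symm
    refine Finset.sum_nbij (fun p => app p ∘ x.symm) ?_ ?_ ?_ ?_
    · intro p _
      simp only [mem_filter, mem_univ, true_and]
      ext t
      obtain ⟨s, rfl⟩ := x.surjective t
      rw [hx]
      simp only [lset, mem_filter, mem_univ, true_and, Function.comp, Equiv.symm_apply_apply]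
      refine Fin.addCases (fun i => ?_) (fun i => ?_) s <;> simp [app]
    · intro p _ q _ h
      have h' : app p = app q := by
        have := congrArg (fun F => F ∘ x) h
        simpa [Function.comp_assoc] using this
      ext i
      · have := congrFun h' (Fin.castAdd b i)
        simpa [app] using this
      · have := congrFun h' (Fin.natAdd a i)
        simpa [app] using this
    · intro f hf
      simp only [coe_filter, mem_univ, true_and, Set.mem_ofPred_eq] at hf
      have hl : ∀ t, (f (x t)).isLeft = true ↔ (t : ℕ) < a := by
        intro t; rw [← hx, ← hf]; simp [lset]
      have h1 : ∀ i : Fin a, ∃ j, f (x (Fin.castAdd b i)) = Sum.inl j := by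
        intro i
        have := (hl (Fin.castAdd b i)).2 (by simp)
        exact Sum.isLeft_iff.1 this
      have h2 : ∀ i : Fin b, ∃ j, f (x (Fin.natAdd a i)) = Sum.inr j := by
        intro i
        have := (hl (Fin.natAdd a i)).not.2 (by simp)
        rw [Bool.not_eq_true, Sum.isLeft_eq_false] at this
        exact Sum.isRight_iff.1 this
      choose f1 hf1 using h1
      choose f2 hf2 using h2
      refine ⟨(f1, f2), by simp, ?_⟩
      ext t : 1
      obtain ⟨s, rfl⟩ := x.surjective t
      simp only [Function.comp, Equiv.symm_apply_apply]
      refine Fin.addCases (fun i => ?_) (fun i => ?_) s <;> simp [app, hf1, hf2]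
    · intro p _
      exact (Wt_conj hφ _ _ x).symm
  rw [e1]
  simp only [Wt_app]
  rw [Finset.sum_comm, Fintype.sum_prod_type]
  refine Finset.sum_congr rfl fun g _ => Finset.sum_congr rfl fun h _ => ?_
  rw [← Finset.mul_sum]
  congr 1
  unfold Pm
  rw [Fintype.sum_prod_type, Finset.sum_mul_sum]

theorem SS_block (nu : PP n) (A : Matrix I I ℂ) (B : Matrix J J ℂ) :
    SS n nu.1 (Matrix.fromBlocks A 0 0 B) = ∑ p ∈ antidiagonal n, ∑ τ : PP p.1, ∑ ρ : PP p.2,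
      (lr τ.1 ρ.1 nu.1 : ℂ) * (SS p.1 τ.1 A * SS p.2 ρ.1 B) := by
  have e0 : SS n nu.1 (Matrix.fromBlocks A 0 0 B) = (Nat.factorial n : ℂ)⁻¹ *
      ∑ f : Fin n → I ⊕ J, Wt (fun σ => (irrChar n nu.1 σ : ℂ)) (Matrix.fromBlocks A 0 0 B) f := by
    unfold SS Wt Pm
    congr 1
    rw [Finset.sum_comm]
    refine Finset.sum_congr rfl fun σ _ => ?_
    rw [mul_comm, Finset.mul_sum]
  rw [e0, ← Finset.sum_fiberwise (s := univ) (g := lset)]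
  obtain ⟨W, hW⟩ : ∃ W : ℕ → ℂ, W = (fun a => ∑ g : Equiv.Perm (Fin a), ∑ h : Equiv.Perm (Fin (n - a)),
        (irrChar (a + (n - a)) nu.1 (sumEmb g h) : ℂ) * (Pm A g * Pm B h)) := ⟨_, rfl⟩
  have e1 : ∀ T : Finset (Fin n), ∑ f ∈ univ.filter (fun f : Fin n → I ⊕ J => lset f = T),
      Wt (fun σ => (irrChar n nu.1 σ : ℂ)) (Matrix.fromBlocks A 0 0 B) f = W T.card := by
    intro T
    rw [hW]
    have key : ∀ a b (hn : n = a + b) (hT : T.card = a),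
        ∑ f ∈ univ.filter (fun f : Fin n → I ⊕ J => lset f = T),
      Wt (fun σ => (irrChar n nu.1 σ : ℂ)) (Matrix.fromBlocks A 0 0 B) f =
      ∑ g : Equiv.Perm (Fin a), ∑ h : Equiv.Perm (Fin b),
        (irrChar (a + b) nu.1 (sumEmb g h) : ℂ) * (Pm A g * Pm B h) := by
      intro a b hn hT
      subst hn
      have := sum_lset (fun σ => (irrChar (a + b) nu.1 σ : ℂ)) (irrChar_class nu.1) A B T hT
      convert this
    exact key _ _ (by have := T.card_le_univ; simp at this; omega) rfl
  rw [Finset.sum_congr rfl fun T _ => e1 T, ← Finset.powerset_univ, Finset.sum_powerset_apply_card W,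
    Finset.card_univ, Fintype.card_fin, Finset.Nat.sum_antidiagonal_eq_sum_range_succ_mk, Finset.mul_sum]
  refine Finset.sum_congr rfl fun a ha => ?_
  rw [hW]
  have han : a ≤ n := by simp at ha; omega
  have hsz : size nu.1 = a + (n - a) := by rw [nu.2]; omega
  have hlr : ∀ (τ : PP a) (ρ : PP (n - a)), (lr τ.1 ρ.1 nu.1 : ℂ) = _ := fun τ ρ =>
    lr_eq τ ρ ⟨nu.1, hsz⟩
  simp only [hlr]
  have hc : (Nat.factorial n : ℂ)⁻¹ * (n.choose a : ℂ) = ((Nat.factorial a : ℂ) * (Nat.factorial (n - a) : ℂ))⁻¹ := by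
    rw [← Nat.choose_mul_factorial_mul_factorial han]
    have h1 := fac_ne a
    have h2 := fac_ne (n - a)
    have h3 : (n.choose a : ℂ) ≠ 0 := by exact_mod_cast (Nat.choose_pos han).ne'
    push_cast
    field_simp
  rw [nsmul_eq_mul, ← mul_assoc, hc]
  simp only [Pm_expand (n := a), Pm_expand (n := n - a), Finset.sum_mul_sum, Finset.mul_sum, Finset.sum_mul]
  conv_lhs =>
    enter [2, g, 2, h]
    rw [Finset.sum_comm]
  conv_lhs =>
    enter [2, g]
    rw [Finset.sum_comm]
  rw [Finset.sum_comm]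
  refine Finset.sum_congr rfl fun τ _ => ?_
  conv_lhs =>
    enter [2, g]
    rw [Finset.sum_comm]
  rw [Finset.sum_comm]
  refine Finset.sum_congr rfl fun ρ _ => Finset.sum_congr rfl fun g _ => Finset.sum_congr rfl fun h _ => ?_
  ring

end blocks
end HD

namespace HD
open Finset Partition'

section schurTrace
variable {n : ℕ} {M : Type*} [AddCommGroup M] [Module ℂ M]

lemma permAction_tprod (σ : Equiv.Perm (Fin n)) (f : Fin n → M) :
    permAction ℂ n M σ (PiTensorProduct.tprod ℂ f) = PiTensorProduct.tprod ℂ (fun i => f (σ.symm i)) :=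
  PiTensorProduct.reindex_tprod _ _

lemma tpow_tprod (g : M →ₗ[ℂ] M) (f : Fin n → M) :
    tpow ℂ n g (PiTensorProduct.tprod ℂ f) = PiTensorProduct.tprod ℂ (fun i => g (f i)) :=
  PiTensorProduct.map_tprod _ _

noncomputable def permHom (n : ℕ) (M : Type*) [AddCommGroup M] [Module ℂ M] :
    Equiv.Perm (Fin n) →* Module.End ℂ (PiTensorProduct ℂ (fun _ : Fin n => M)) where
  toFun σ := permAction ℂ n M σ
  map_one' := by
    apply PiTensorProduct.ext
    ext f
    simp only [LinearMap.compMultilinearMap_apply, permAction_tprod]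
    rfl
  map_mul' σ τ := by
    apply PiTensorProduct.ext
    ext f
    simp only [LinearMap.compMultilinearMap_apply, Module.End.mul_apply, permAction_tprod]
    rfl

lemma tpow_one : tpow ℂ n (1 : M →ₗ[ℂ] M) = 1 := by
  apply PiTensorProduct.ext
  ext f
  simp only [LinearMap.compMultilinearMap_apply, tpow_tprod]
  rfl

lemma tpow_mul (g h : M →ₗ[ℂ] M) : tpow ℂ n (g ∘ₗ h) = tpow ℂ n g ∘ₗ tpow ℂ n h := by
  apply PiTensorProduct.ext
  ext f
  simp only [LinearMap.compMultilinearMap_apply, LinearMap.comp_apply, tpow_tprod]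

lemma tpow_perm (g : M →ₗ[ℂ] M) (σ : Equiv.Perm (Fin n)) :
    tpow ℂ n g ∘ₗ permAction ℂ n M σ = permAction ℂ n M σ ∘ₗ tpow ℂ n g := by
  apply PiTensorProduct.ext
  ext f
  simp only [LinearMap.compMultilinearMap_apply, LinearMap.comp_apply, tpow_tprod, permAction_tprod]

noncomputable abbrev liftP (n : ℕ) (M : Type*) [AddCommGroup M] [Module ℂ M] :
    MonoidAlgebra ℂ (Equiv.Perm (Fin n)) →ₐ[ℂ] Module.End ℂ (PiTensorProduct ℂ (fun _ : Fin n => M)) :=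
  MonoidAlgebra.lift ℂ _ _ (permHom n M)

lemma liftP_gg (σ : Equiv.Perm (Fin n)) : liftP n M (gg σ) = permAction ℂ n M σ := by
  simp [liftP, gg, permHom]

lemma young_eq (l : Partition') : youngSymmetrizer ℂ l M =
    liftP (size l) M (altSum (fun t : Fin (size l) => colOf l t) * stabSum (fun t : Fin (size l) => rowOf l t)) := by
  rw [map_mul]
  simp only [altSum, stabSum, map_sum, map_smul, liftP_gg]
  unfold youngSymmetrizer
  rw [Module.End.mul_eq_comp]

lemma liftP_sum (u : MonoidAlgebra ℂ (Equiv.Perm (Fin n))) :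
    liftP n M u = ∑ σ, u.coeff σ • permAction ℂ n M σ := by
  conv_lhs => rw [eq_sum_gg u]
  simp only [map_sum, map_smul, liftP_gg]

lemma tpow_young (l : Partition') (g : M →ₗ[ℂ] M) :
    tpow ℂ (size l) g ∘ₗ youngSymmetrizer ℂ l M = youngSymmetrizer ℂ l M ∘ₗ tpow ℂ (size l) g := by
  rw [young_eq, liftP_sum, ← Module.End.mul_eq_comp, ← Module.End.mul_eq_comp, Finset.mul_sum, Finset.sum_mul]
  refine Finset.sum_congr rfl fun σ _ => ?_
  rw [Module.End.mul_eq_comp, Module.End.mul_eq_comp, LinearMap.comp_smul, LinearMap.smul_comp, tpow_perm]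

lemma schur_inv (l : Partition') (g : M →ₗ[ℂ] M) :
    ∀ x ∈ schur ℂ l M, tpow ℂ (size l) g x ∈ schur ℂ l M := by
  rintro x ⟨v, rfl⟩
  exact ⟨tpow ℂ (size l) g v, (LinearMap.congr_fun (tpow_young l g) v).symm⟩

lemma young_sq (l : Partition') : youngSymmetrizer ℂ l M ∘ₗ youngSymmetrizer ℂ l M =
    hh (fun t : Fin (size l) => rowOf l t) (fun t : Fin (size l) => colOf l t) • youngSymmetrizer ℂ l M := by
  rw [young_eq, ← Module.End.mul_eq_comp, ← map_mul, c_sq (tab l rfl), map_smul]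

variable {I : Type*} [Fintype I] [DecidableEq I] (b : Module.Basis I ℂ M)

lemma trace_perm (g : M →ₗ[ℂ] M) (σ : Equiv.Perm (Fin n)) :
    LinearMap.trace ℂ _ (tpow ℂ n g ∘ₗ permAction ℂ n M σ) = Pm (LinearMap.toMatrix b b g) σ := by
  rw [LinearMap.trace_eq_matrix_trace ℂ (Basis.piTensorProduct (fun _ : Fin n => b)), Matrix.trace]
  unfold Pm
  refine Finset.sum_congr rfl fun f _ => ?_
  rw [Matrix.diag_apply, LinearMap.toMatrix_apply, Basis.piTensorProduct_apply, LinearMap.comp_apply,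
    permAction_tprod, tpow_tprod, Basis.piTensorProduct_repr_tprod_apply, ← Equiv.prod_comp σ]
  simp [LinearMap.toMatrix_apply]

instance fd_pi [FiniteDimensional ℂ M] : FiniteDimensional ℂ (PiTensorProduct ℂ (fun _ : Fin n => M)) :=
  Module.Finite.of_basis (Basis.piTensorProduct (fun _ : Fin n => Module.finBasis ℂ M))

theorem trace_schur [FiniteDimensional ℂ M] (l : Partition') (g : M →ₗ[ℂ] M)
    (hi : ∀ x ∈ schur ℂ l M, tpow ℂ (size l) g x ∈ schur ℂ l M) :
    LinearMap.trace ℂ (schur ℂ l M) ((tpow ℂ (size l) g).restrict hi) =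
      SS (size l) l (LinearMap.toMatrix b b g) := by
  have h := trace_range (youngSymmetrizer ℂ l M) (tpow ℂ (size l) g) _ (hh_ne_zero (tab l rfl))
    (young_sq l) (tpow_young l g) hi
  refine h.trans ?_
  rw [young_eq, liftP_sum, ← Module.End.mul_eq_comp, Finset.mul_sum, map_sum]
  simp only [Module.End.mul_eq_comp, LinearMap.comp_smul, map_smul, smul_eq_mul, trace_perm b]
  have := inner_chi (fun t : Fin (size l) => rowOf l t) (fun t : Fin (size l) => colOf l t)
    (Pm_class (n := size l) (LinearMap.toMatrix b b g))
  unfold SS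
  simp only [irr_eq_chi l rfl]
  simp only [mul_comm (Pm _ _)]
  rw [this, inv_mul_cancel_left₀ (fac_ne _)]

end schurTrace
end HD

namespace HD
open Finset Partition'

section combine

noncomputable def FP (N : ℕ) : Finset Partition' :=
  (range (N + 1)).biUnion (fun n => univ.image (Subtype.val : PP n → Partition'))

lemma mem_FP {N : ℕ} {l : Partition'} : l ∈ FP N ↔ size l ≤ N := by
  unfold FP
  simp only [mem_biUnion, mem_range, mem_image, mem_univ, true_and]
  constructor
  · rintro ⟨n, hn, ⟨m, hm⟩, rfl⟩
    show size m ≤ N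
    omega
  · intro h
    exact ⟨size l, by omega, ⟨l, rfl⟩, rfl⟩

lemma sum_PP {N n : ℕ} (hn : n ≤ N) (f : Partition' → ℂ) (h : ∀ l, size l ≠ n → f l = 0) :
    ∑ l : PP n, f l.1 = ∑ l ∈ FP N, f l := by
  refine Finset.sum_of_injOn Subtype.val (Subtype.val_injective.injOn) ?_ ?_ (fun _ _ => rfl)
  · intro l _
    have := l.2
    simp only [mem_coe, mem_FP]; omega
  · intro l _ hl
    apply h
    intro h2
    exact hl ⟨⟨l, h2⟩, by simp, rfl⟩

lemma lr_zero {a b c : Partition'} (h : size c ≠ size a + size b) : lr a b c = 0 := if_neg h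
lemma kron_zero {a b c : Partition'} (h : ¬ (size a = size c ∧ size b = size c)) : kron a b c = 0 := if_neg h

variable {I J : Type*} [Fintype I] [Fintype J]

noncomputable abbrev S (l : Partition') (A : Matrix I I ℂ) : ℂ := SS (size l) l A

lemma S_mul {N : ℕ} (A : Matrix I I ℂ) (a b : Partition') (h : size a + size b ≤ N) :
    S a A * S b A = ∑ l ∈ FP N, (lr a b l : ℂ) * S l A := by
  have := SS_mul A ⟨a, rfl⟩ ⟨b, rfl⟩
  refine this.trans ?_
  rw [← sum_PP h (fun l => (lr a b l : ℂ) * S l A)]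
  · refine Finset.sum_congr rfl fun l _ => ?_
    show _ * SS (size a + size b) l.1 A = _ * SS (size l.1) l.1 A
    rw [l.2]
  · intro l hl
    simp [lr_zero hl]

lemma S_kron {N : ℕ} (A : Matrix I I ℂ) (B : Matrix J J ℂ) (d : Partition') (h : size d ≤ N) :
    S d (Matrix.kroneckerMap (· * ·) A B) =
      ∑ b ∈ FP N, ∑ e ∈ FP N, (kron b e d : ℂ) * (S b A * S e B) := by
  refine (SS_kron A B ⟨d, rfl⟩).trans ?_
  rw [← sum_PP h (fun b => ∑ e ∈ FP N, (kron b e d : ℂ) * (S b A * S e B))]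
  · refine Finset.sum_congr rfl fun b _ => ?_
    rw [← sum_PP h (fun e => (kron b e d : ℂ) * (S b A * S e B))]
    · refine Finset.sum_congr rfl fun e _ => ?_
      show _ * (SS (size d) b.1 A * SS (size d) e.1 B) = _ * (SS (size b.1) b.1 A * SS (size e.1) e.1 B)
      rw [b.2, e.2]
    · intro l hl
      rw [kron_zero (fun h => hl h.2)]; simp
  · intro l hl
    refine Finset.sum_eq_zero fun e _ => ?_
    rw [kron_zero (fun h => hl h.1)]; simp

lemma S_block {N : ℕ} (A : Matrix I I ℂ) (B : Matrix J J ℂ) (nu : Partition') (h : size nu ≤ N) :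
    S nu (Matrix.fromBlocks A 0 0 B) =
      ∑ t ∈ FP N, ∑ r ∈ FP N, (lr t r nu : ℂ) * (S t A * S r B) := by
  refine (SS_block ⟨nu, rfl⟩ A B).trans ?_
  have e1 : ∀ p ∈ antidiagonal (size nu), (∑ τ : PP p.1, ∑ ρ : PP p.2,
      (lr τ.1 ρ.1 nu : ℂ) * (SS p.1 τ.1 A * SS p.2 ρ.1 B)) =
      ∑ t ∈ FP N, ∑ r ∈ FP N, if p = (size t, size r) then (lr t r nu : ℂ) * (S t A * S r B) else 0 := by
    rintro ⟨x, y⟩ hp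
    simp only [HasAntidiagonal.mem_antidiagonal] at hp
    rw [← sum_PP (show x ≤ N by omega) (fun t => ∑ r ∈ FP N, if (x, y) = (size t, size r) then (lr t r nu : ℂ) * (S t A * S r B) else 0)]
    · refine Finset.sum_congr rfl fun b _ => ?_
      rw [← sum_PP (show y ≤ N by omega) (fun e => if (x, y) = (size b.1, size e) then (lr b.1 e nu : ℂ) * (S b.1 A * S e B) else 0)]
      · refine Finset.sum_congr rfl fun e _ => ?_
        rw [if_pos (by rw [b.2, e.2])]
        show _ * (SS x b.1 A * SS y e.1 B) = _ * (SS (size b.1) b.1 A * SS (size e.1) e.1 B)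
        rw [b.2, e.2]
      · intro l hl
        rw [if_neg]; rintro h; simp at h; exact hl h.2.symm
    · intro l hl
      refine Finset.sum_eq_zero fun e _ => ?_
      rw [if_neg]; rintro h; simp at h; exact hl h.1.symm
  rw [Finset.sum_congr rfl e1, Finset.sum_comm]
  refine Finset.sum_congr rfl fun t _ => ?_
  rw [Finset.sum_comm]
  refine Finset.sum_congr rfl fun r _ => ?_
  rw [Finset.sum_ite_eq']
  split_ifs with h2
  · rfl
  · rw [lr_zero]
    · simp
    · intro h3; exact h2 (by simp [h3])

lemma finsum_nest {P : Type*} (F : Finset P) (t : P → P → P → P → P → P → ℕ)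
    (h : ∀ a b c d e f, t a b c d e f ≠ 0 → a ∈ F ∧ b ∈ F ∧ c ∈ F ∧ d ∈ F ∧ e ∈ F ∧ f ∈ F) :
    (∑ᶠ (a) (b) (c) (d) (e) (f), t a b c d e f) = ∑ a ∈ F, ∑ b ∈ F, ∑ c ∈ F, ∑ d ∈ F, ∑ e ∈ F, ∑ f ∈ F,
      t a b c d e f := by
  have key : ∀ g : P → ℕ, (∀ x, x ∉ F → g x = 0) → ∑ᶠ x, g x = ∑ x ∈ F, g x := by
    intro g hg
    apply finsum_eq_sum_of_support_subset
    intro x hx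
    by_contra h2
    exact hx (hg x h2)
  have h' : ∀ a b c d e f, ¬ (a ∈ F ∧ b ∈ F ∧ c ∈ F ∧ d ∈ F ∧ e ∈ F ∧ f ∈ F) → t a b c d e f = 0 := by
    intro a b c d e f hn
    by_contra h0
    exact hn (h _ _ _ _ _ _ h0)
  rw [key]
  · refine Finset.sum_congr rfl fun a _ => ?_
    rw [key]
    · refine Finset.sum_congr rfl fun b _ => ?_
      rw [key]
      · refine Finset.sum_congr rfl fun c _ => ?_
        rw [key]
        · refine Finset.sum_congr rfl fun d _ => ?_
          rw [key]
          · refine Finset.sum_congr rfl fun e _ => ?_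
            rw [key]
            intro x hx; exact h' _ _ _ _ _ _ (by tauto)
          intro x hx
          rw [finsum_eq_zero_of_forall_eq_zero]; intro f; exact h' _ _ _ _ _ _ (by tauto)
        intro x hx
        rw [finsum_eq_zero_of_forall_eq_zero]; intro e
        rw [finsum_eq_zero_of_forall_eq_zero]; intro f; exact h' _ _ _ _ _ _ (by tauto)
      intro x hx
      rw [finsum_eq_zero_of_forall_eq_zero]; intro d
      rw [finsum_eq_zero_of_forall_eq_zero]; intro e
      rw [finsum_eq_zero_of_forall_eq_zero]; intro f; exact h' _ _ _ _ _ _ (by tauto)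
    intro x hx
    rw [finsum_eq_zero_of_forall_eq_zero]; intro c
    rw [finsum_eq_zero_of_forall_eq_zero]; intro d
    rw [finsum_eq_zero_of_forall_eq_zero]; intro e
    rw [finsum_eq_zero_of_forall_eq_zero]; intro f; exact h' _ _ _ _ _ _ (by tauto)
  intro x hx
  rw [finsum_eq_zero_of_forall_eq_zero]; intro b
  rw [finsum_eq_zero_of_forall_eq_zero]; intro c
  rw [finsum_eq_zero_of_forall_eq_zero]; intro d
  rw [finsum_eq_zero_of_forall_eq_zero]; intro e
  rw [finsum_eq_zero_of_forall_eq_zero]; intro f; exact h' _ _ _ _ _ _ (by tauto)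

lemma term_bound {a b d e r t l m nu : Partition'}
    (h : lr a b l * lr e r m * kron b e d * lr a d t * lr t r nu ≠ 0) :
    (a ∈ FP (size nu) ∧ b ∈ FP (size nu) ∧ d ∈ FP (size nu) ∧ e ∈ FP (size nu) ∧ r ∈ FP (size nu) ∧
      t ∈ FP (size nu)) ∧ size l ≤ size nu + size nu ∧ size m ≤ size nu + size nu := by
  simp only [mul_ne_zero_iff] at h
  obtain ⟨⟨⟨⟨h1, h2⟩, h3⟩, h4⟩, h5⟩ := h
  have h1 := not_imp_comm.1 lr_zero h1
  have h2 := not_imp_comm.1 lr_zero h2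
  have h3 := not_imp_comm.1 kron_zero h3
  have h4 := not_imp_comm.1 lr_zero h4
  have h5 := not_imp_comm.1 lr_zero h5
  simp only [mem_FP]
  omega

lemma aguiar_eq (l m nu : Partition') : aguiar l m nu = ∑ a ∈ FP (size nu), ∑ b ∈ FP (size nu),
    ∑ d ∈ FP (size nu), ∑ e ∈ FP (size nu), ∑ r ∈ FP (size nu), ∑ t ∈ FP (size nu),
    lr a b l * lr e r m * kron b e d * lr a d t * lr t r nu := by
  unfold aguiar
  exact finsum_nest _ _ (fun a b d e r t h => (term_bound h).1)

lemma aguiar_zero {l m nu : Partition'} (h : ¬ (l ∈ FP (size nu + size nu) ∧ m ∈ FP (size nu + size nu))) :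
    aguiar l m nu = 0 := by
  rw [aguiar_eq]
  refine Finset.sum_eq_zero fun a _ => Finset.sum_eq_zero fun b _ => Finset.sum_eq_zero fun d _ =>
    Finset.sum_eq_zero fun e _ => Finset.sum_eq_zero fun r _ => Finset.sum_eq_zero fun t _ => ?_
  by_contra h0
  have := (term_bound h0).2
  simp only [mem_FP] at h
  exact h this

lemma reorder {P : Type*} (F : Finset P) (T : P → P → P → P → P → P → ℂ) :
    ∑ t ∈ F, ∑ r ∈ F, ∑ a ∈ F, ∑ d ∈ F, ∑ b ∈ F, ∑ e ∈ F, T a b d e r t =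
    ∑ a ∈ F, ∑ b ∈ F, ∑ d ∈ F, ∑ e ∈ F, ∑ r ∈ F, ∑ t ∈ F, T a b d e r t := by
  simp only [← Finset.sum_product']
  refine Finset.sum_nbij' (fun x => (x.2.2.1, x.2.2.2.2.1, x.2.2.2.1, x.2.2.2.2.2, x.2.1, x.1))
    (fun y => (y.2.2.2.2.2, y.2.2.2.2.1, y.1, y.2.2.1, y.2.1, y.2.2.2.1)) ?_ ?_ ?_ ?_ ?_
  · intro x hx; simp only [mem_product] at hx ⊢; tauto
  · intro x hx; simp only [mem_product] at hx ⊢; tauto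
  · intro x _; rfl
  · intro x _; rfl
  · intro x _; rfl

theorem S_main (A : Matrix I I ℂ) (B : Matrix J J ℂ) (nu : Partition') :
    S nu (Matrix.fromBlocks (Matrix.fromBlocks A 0 0 (Matrix.kroneckerMap (· * ·) A B)) 0 0 B) =
    ∑ l ∈ FP (size nu + size nu), ∑ m ∈ FP (size nu + size nu), (aguiar l m nu : ℂ) * (S l A * S m B) := by
  have hL : S nu (Matrix.fromBlocks (Matrix.fromBlocks A 0 0 (Matrix.kroneckerMap (· * ·) A B)) 0 0 B) =
      ∑ t ∈ FP (size nu), ∑ r ∈ FP (size nu), ∑ a ∈ FP (size nu), ∑ d ∈ FP (size nu),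
        ∑ b ∈ FP (size nu), ∑ e ∈ FP (size nu),
        (kron b e d * lr a d t * lr t r nu : ℂ) * ((S a A * S b A) * (S e B * S r B)) := by
    rw [S_block (N := size nu) _ _ _ le_rfl]
    refine Finset.sum_congr rfl fun t ht => Finset.sum_congr rfl fun r hr => ?_
    rw [S_block (N := size nu) _ _ _ (mem_FP.1 ht), Finset.sum_mul, Finset.mul_sum]
    refine Finset.sum_congr rfl fun a ha => ?_
    rw [Finset.sum_mul, Finset.mul_sum]
    refine Finset.sum_congr rfl fun d hd => ?_
    rw [S_kron (N := size nu) _ _ _ (mem_FP.1 hd)]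
    simp only [Finset.sum_mul, Finset.mul_sum]
    refine Finset.sum_congr rfl fun b _ => Finset.sum_congr rfl fun e _ => ?_
    ring
  rw [hL, reorder (FP (size nu)) (fun a b d e r t =>
    (kron b e d * lr a d t * lr t r nu : ℂ) * ((S a A * S b A) * (S e B * S r B)))]
  simp only [aguiar_eq, Nat.cast_sum, Finset.sum_mul]
  have pull : ∀ T : Partition' → Partition' → Partition' → Partition' → Partition' → Partition' →
      Partition' → Partition' → ℂ, ∀ (F G : Finset Partition'),
      ∑ l ∈ G, ∑ m ∈ G, ∑ a ∈ F, ∑ b ∈ F, ∑ d ∈ F, ∑ e ∈ F, ∑ r ∈ F, ∑ t ∈ F, T l m a b d e r t =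
      ∑ a ∈ F, ∑ b ∈ F, ∑ d ∈ F, ∑ e ∈ F, ∑ r ∈ F, ∑ t ∈ F, ∑ l ∈ G, ∑ m ∈ G, T l m a b d e r t := by
    intro T F G
    simp only [← Finset.sum_product']
    refine Finset.sum_nbij' (fun x => (x.2.2.1, x.2.2.2.1, x.2.2.2.2.1, x.2.2.2.2.2.1, x.2.2.2.2.2.2.1,
        x.2.2.2.2.2.2.2, x.1, x.2.1))
      (fun y => (y.2.2.2.2.2.2.1, y.2.2.2.2.2.2.2, y.1, y.2.1, y.2.2.1, y.2.2.2.1, y.2.2.2.2.1, y.2.2.2.2.2.1)) ?_ ?_ ?_ ?_ ?_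
    · intro x hx; simp only [mem_product] at hx ⊢; tauto
    · intro x hx; simp only [mem_product] at hx ⊢; tauto
    · intro x _; rfl
    · intro x _; rfl
    · intro x _; rfl
  rw [pull]
  refine Finset.sum_congr rfl fun a ha => Finset.sum_congr rfl fun b hb => Finset.sum_congr rfl fun d _ =>
    Finset.sum_congr rfl fun e he => Finset.sum_congr rfl fun r hr => Finset.sum_congr rfl fun t _ => ?_
  rw [mem_FP] at ha hb he hr
  rw [S_mul (N := size nu + size nu) A a b (by omega), S_mul (N := size nu + size nu) B e r (by omega),
    Finset.sum_mul_sum, Finset.mul_sum]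
  refine Finset.sum_congr rfl fun l _ => ?_
  rw [Finset.mul_sum]
  refine Finset.sum_congr rfl fun m _ => ?_
  push_cast
  ring

end combine
end HD

namespace HD

section isoTrace
variable {R : Type*} [Ring R] [Algebra ℂ R]

noncomputable def tr (R : Type*) [Ring R] [Algebra ℂ R] (X : Type*) [AddCommGroup X] [Module ℂ X] [Module R X]
    [IsScalarTower ℂ R X] (r : R) : ℂ :=
  LinearMap.trace ℂ X (Algebra.lsmul ℂ ℂ X r)

variable {X Y : Type*} [AddCommGroup X] [Module ℂ X] [Module R X] [IsScalarTower ℂ R X] [FiniteDimensional ℂ X]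
  [AddCommGroup Y] [Module ℂ Y] [Module R Y] [IsScalarTower ℂ R Y] [FiniteDimensional ℂ Y]

lemma tr_congr (e : X ≃ₗ[R] Y) (r : R) : tr R X r = tr R Y r := by
  unfold tr
  rw [← LinearMap.trace_conj' _ (e.restrictScalars ℂ)]
  congr 1
  ext y
  simp [LinearEquiv.conj_apply]

lemma tr_prod (r : R) : tr R (X × Y) r = tr R X r + tr R Y r := by
  unfold tr
  rw [← LinearMap.trace_prodMap']
  congr 1

lemma tr_compl {p q : Submodule R X} (h : IsCompl p q) (r : R) : tr R X r = tr R p r + tr R q r := by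
  haveI : FiniteDimensional ℂ p := inferInstanceAs (FiniteDimensional ℂ (p.restrictScalars ℂ))
  haveI : FiniteDimensional ℂ q := inferInstanceAs (FiniteDimensional ℂ (q.restrictScalars ℂ))
  rw [← tr_prod, tr_congr (Submodule.prodEquivOfIsCompl p q h)]

lemma density_case [IsSemisimpleModule R X] [IsSemisimpleModule R Y] (hXY : ∀ f : X →ₗ[R] Y, f = 0)
    (hYX : ∀ f : Y →ₗ[R] X, f = 0) : ∃ r : R, (∀ x : X, r • x = x) ∧ ∀ y : Y, r • y = 0 := by
  haveI : IsSemisimpleModule R (X × Y) := by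
    have h := IsSemisimpleModule.sup (R := R) (M := X × Y) (IsSemisimpleModule.range (LinearMap.inl R X Y))
      (IsSemisimpleModule.range (LinearMap.inr R X Y))
    rw [LinearMap.sup_range_inl_inr] at h
    exact IsSemisimpleModule.congr (Submodule.topEquiv (R := R) (M := X × Y)).symm
  let T : Module.End (Module.End R (X × Y)) (X × Y) :=
    { toFun := fun v => (v.1, 0)
      map_add' := by intro u v; simp
      map_smul' := by
        intro φ v
        have h1 := LinearMap.congr_fun (hXY (LinearMap.snd R X Y ∘ₗ φ ∘ₗ LinearMap.inl R X Y)) v.1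
        have h2 := LinearMap.congr_fun (hYX (LinearMap.fst R X Y ∘ₗ φ ∘ₗ LinearMap.inr R X Y)) v.2
        simp only [LinearMap.comp_apply, LinearMap.inl_apply, LinearMap.inr_apply, LinearMap.fst_apply,
          LinearMap.snd_apply, LinearMap.zero_apply] at h1 h2
        have h3 : φ v = φ (v.1, 0) + φ (0, v.2) := by rw [← map_add]; simp
        simp only [Module.End.smul_def, RingHom.id_apply, h3]
        ext
        · simp [h2]
        · simp [h1] }
  obtain ⟨s, hs⟩ := (inferInstance : FiniteDimensional ℂ (X × Y)).fg_top
  obtain ⟨r, hr⟩ := jacobson_density T s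
  have key : ∀ v : X × Y, r • v = (v.1, 0) := by
    intro v
    have hv : v ∈ Submodule.span ℂ (s : Set (X × Y)) := by rw [hs]; trivial
    induction hv using Submodule.span_induction with
    | mem v hv => exact (hr v hv).symm
    | zero => simp; rfl
    | add a b _ _ ha hb => rw [smul_add, ha, hb]; simp
    | smul c a _ ha =>
      have : r • c • a = c • r • a := (Algebra.lsmul ℂ ℂ (X × Y) r).map_smul c a
      rw [this, ha]; simp
  refine ⟨r, fun x => ?_, fun y => ?_⟩
  · have := congrArg Prod.fst (key (x, 0)); simpa using this
  · have := congrArg Prod.snd (key (0, y)); simpa using this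

lemma rank_zero_of_density (h : ∀ r : R, tr R X r = tr R Y r) (r : R) (h1 : ∀ x : X, r • x = x)
    (h2 : ∀ y : Y, r • y = 0) : Subsingleton X := by
  have e1 : tr R X r = Module.finrank ℂ X := by
    unfold tr
    have : Algebra.lsmul ℂ ℂ X r = LinearMap.id := by ext x; simp [h1]
    rw [this, LinearMap.trace_id]
  have e2 : tr R Y r = 0 := by
    unfold tr
    have : Algebra.lsmul ℂ ℂ Y r = 0 := by ext x; simp [h2]
    rw [this, map_zero]
  have := h r
  rw [e1, e2] at this
  exact Module.finrank_zero_iff.1 (by exact_mod_cast this)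

end isoTrace

universe u v w

theorem iso_of_trace {R : Type u} [Ring R] [Algebra ℂ R] (n : ℕ) :
    ∀ (X : Type v) (Y : Type w) [AddCommGroup X] [Module ℂ X] [Module R X] [IsScalarTower ℂ R X] [FiniteDimensional ℂ X]
    [AddCommGroup Y] [Module ℂ Y] [Module R Y] [IsScalarTower ℂ R Y] [FiniteDimensional ℂ Y]
    [IsSemisimpleModule R X] [IsSemisimpleModule R Y] (hn : Module.finrank ℂ X + Module.finrank ℂ Y ≤ n)
    (h : ∀ r : R, tr R X r = tr R Y r), Nonempty (X ≃ₗ[R] Y) := by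
  induction n using Nat.strong_induction_on with
  | _ n ih =>
  intro X Y _ _ _ _ _ _ _ _ _ _ _ _ hn h
  have step : ∀ (K : Submodule R X) (X₁ : Submodule R X) (I : Submodule R Y) (Y₁ : Submodule R Y)
      (h1 : IsCompl K X₁) (h2 : IsCompl I Y₁) (e : X₁ ≃ₗ[R] I) (hne : X₁ ≠ ⊥), Nonempty (X ≃ₗ[R] Y) := by
    intro K X₁ I Y₁ h1 h2 e hne
    haveI : FiniteDimensional ℂ K := inferInstanceAs (FiniteDimensional ℂ (K.restrictScalars ℂ))
    haveI : FiniteDimensional ℂ X₁ := inferInstanceAs (FiniteDimensional ℂ (X₁.restrictScalars ℂ))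
    haveI : FiniteDimensional ℂ I := inferInstanceAs (FiniteDimensional ℂ (I.restrictScalars ℂ))
    haveI : FiniteDimensional ℂ Y₁ := inferInstanceAs (FiniteDimensional ℂ (Y₁.restrictScalars ℂ))
    have d1 : Module.finrank ℂ X = Module.finrank ℂ K + Module.finrank ℂ X₁ := by
      rw [← Module.finrank_prod]
      exact ((Submodule.prodEquivOfIsCompl K X₁ h1).restrictScalars ℂ).finrank_eq.symm
    have d2 : Module.finrank ℂ Y = Module.finrank ℂ I + Module.finrank ℂ Y₁ := by
      rw [← Module.finrank_prod]
      exact ((Submodule.prodEquivOfIsCompl I Y₁ h2).restrictScalars ℂ).finrank_eq.symm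
    have d3 : 0 < Module.finrank ℂ X₁ := by
      haveI : Nontrivial X₁ := Submodule.nontrivial_iff_ne_bot.2 hne
      exact Module.finrank_pos
    obtain ⟨e2⟩ := ih (Module.finrank ℂ K + Module.finrank ℂ Y₁) (by omega) K Y₁ le_rfl (by
      intro r
      have a1 := tr_compl h1 r
      have a2 := tr_compl h2 r
      have a3 := tr_congr e r
      have a4 := h r
      rw [a1, a2, a3, add_comm] at a4
      exact add_left_cancel a4)
    exact ⟨(Submodule.prodEquivOfIsCompl K X₁ h1).symm ≪≫ₗ (LinearEquiv.prodCongr e2 e) ≪≫ₗ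
      (Submodule.prodEquivOfIsCompl Y₁ I h2.symm)⟩
  by_cases hXY : ∀ f : X →ₗ[R] Y, f = 0
  · by_cases hYX : ∀ f : Y →ₗ[R] X, f = 0
    · obtain ⟨r, h1, h2⟩ := density_case hXY hYX
      obtain ⟨r', h1', h2'⟩ := density_case hYX hXY
      haveI := rank_zero_of_density h r h1 h2
      haveI := rank_zero_of_density (fun r => (h r).symm) r' h1' h2'
      exact ⟨0⟩
    · push Not at hYX
      obtain ⟨f, hf⟩ := hYX
      obtain ⟨Y₁, hY₁⟩ := exists_isCompl (LinearMap.ker f)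
      obtain ⟨K, hK⟩ := exists_isCompl (LinearMap.range f)
      refine step K (LinearMap.range f) Y₁ (LinearMap.ker f) hK.symm hY₁.symm ?_ ?_
      · exact (f.quotKerEquivRange.symm ≪≫ₗ Submodule.quotientEquivOfIsCompl _ _ hY₁)
      · rwa [Ne, LinearMap.range_eq_bot]
  · push Not at hXY
    obtain ⟨f, hf⟩ := hXY
    obtain ⟨X₁, hX₁⟩ := exists_isCompl (LinearMap.ker f)
    obtain ⟨Y₁, hY₁⟩ := exists_isCompl (LinearMap.range f)
    refine step (LinearMap.ker f) X₁ (LinearMap.range f) Y₁ hX₁ hY₁ ?_ ?_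
    · exact (Submodule.quotientEquivOfIsCompl _ _ hX₁).symm ≪≫ₗ f.quotKerEquivRange
    · rintro rfl
      apply hf
      have := hX₁.sup_eq_top
      rw [sup_bot_eq] at this
      exact LinearMap.ker_eq_top.1 this

end HD

namespace HD
open Partition'

section adj
variable {I : Type*} [Fintype I] [DecidableEq I] {W : Type*} [AddCommGroup W] [Module ℂ W]

def Adj (b : Module.Basis I ℂ W) (T T' : W →ₗ[ℂ] W) : Prop :=
  LinearMap.toMatrix b b T' = (LinearMap.toMatrix b b T).conjTranspose

noncomputable def toE (b : Module.Basis I ℂ W) : W ≃ₗ[ℂ] EuclideanSpace ℂ I :=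
  b.equivFun.trans (WithLp.linearEquiv 2 ℂ (I → ℂ)).symm

lemma toE_inner (b : Module.Basis I ℂ W) (u w : W) :
    inner ℂ (toE b u) (toE b w) = dotProduct (b.repr w : I → ℂ) (star (b.repr u : I → ℂ)) := by
  rw [EuclideanSpace.inner_eq_star_dotProduct]
  rfl

lemma Adj.inner {b : Module.Basis I ℂ W} {T T' : W →ₗ[ℂ] W} (h : Adj b T T') (u w : W) :
    inner ℂ (toE b u) (toE b (T w)) = inner ℂ (toE b (T' u)) (toE b w) := by
  rw [toE_inner, toE_inner, ← LinearMap.toMatrix_mulVec_repr b b T, ← LinearMap.toMatrix_mulVec_repr b b T', h,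
    Matrix.star_mulVec, Matrix.conjTranspose_conjTranspose, dotProduct_comm, Matrix.dotProduct_mulVec, dotProduct_comm]

theorem ss_of_adj {G : Type*} [Group G] (ρ : Representation ℂ G W) (b : Module.Basis I ℂ W)
    (h : ∀ g, ∃ g', Adj b (ρ g) (ρ g')) : IsSemisimpleModule (MonoidAlgebra ℂ G) ρ.asModule := by
  rw [← Representation.isSemisimpleRepresentation_iff_isSemisimpleModule_asModule]
  refine ⟨fun p => ?_⟩
  let K : Submodule ℂ (EuclideanSpace ℂ I) := p.toSubmodule.map (toE b).toLinearMap
  have hmem : ∀ u ∈ p.toSubmodule, toE b u ∈ K := fun u hu => Submodule.mem_map_of_mem hu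
  let q : Subrepresentation ρ :=
    { toSubmodule := Kᗮ.comap (toE b).toLinearMap
      apply_mem_toSubmodule := by
        intro g w hw
        rw [Submodule.mem_comap, Submodule.mem_orthogonal] at hw ⊢
        rintro _ ⟨u, hu, rfl⟩
        obtain ⟨g', hg'⟩ := h g
        exact (hg'.inner u w).trans (hw _ (hmem _ (p.apply_mem_toSubmodule g' hu))) }
  have hc : IsCompl K Kᗮ := Submodule.isCompl_orthogonal_of_hasOrthogonalProjection
  refine ⟨q, ?_, ?_⟩
  · rw [disjoint_iff]
    apply Subrepresentation.toSubmodule_injective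
    change p.toSubmodule ⊓ Kᗮ.comap (toE b).toLinearMap = ⊥
    rw [eq_bot_iff]
    rintro x ⟨h1, h2⟩
    have h3 : toE b x ∈ K ⊓ Kᗮ := ⟨hmem _ h1, h2⟩
    rw [hc.inf_eq_bot, Submodule.mem_bot] at h3
    simpa using h3
  · rw [codisjoint_iff]
    apply Subrepresentation.toSubmodule_injective
    change p.toSubmodule ⊔ Kᗮ.comap (toE b).toLinearMap = ⊤
    rw [eq_top_iff]
    intro x _
    have h3 : toE b x ∈ K ⊔ Kᗮ := by rw [hc.sup_eq_top]; trivial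
    rw [Submodule.mem_sup] at h3 ⊢
    obtain ⟨_, ⟨u, hu, rfl⟩, z, hz, hs⟩ := h3
    refine ⟨u, hu, (toE b).symm z, ?_, ?_⟩
    · rw [Submodule.mem_comap]; simpa using hz
    · apply (toE b).injective
      rw [map_add, LinearEquiv.apply_symm_apply]
      exact hs

lemma Adj.prod {I' : Type*} [Fintype I'] [DecidableEq I'] {W' : Type*} [AddCommGroup W'] [Module ℂ W']
    {b : Module.Basis I ℂ W} {b' : Module.Basis I' ℂ W'} {T T' : W →ₗ[ℂ] W} {S S' : W' →ₗ[ℂ] W'}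
    (h : Adj b T T') (h' : Adj b' S S') : Adj (b.prod b') (T.prodMap S) (T'.prodMap S') := by
  unfold Adj at *
  rw [LinearMap.toMatrix_prodMap, LinearMap.toMatrix_prodMap, h, h', Matrix.fromBlocks_conjTranspose]
  simp

lemma Adj.tensor {I' : Type*} [Fintype I'] [DecidableEq I'] {W' : Type*} [AddCommGroup W'] [Module ℂ W']
    {b : Module.Basis I ℂ W} {b' : Module.Basis I' ℂ W'} {T T' : W →ₗ[ℂ] W} {S S' : W' →ₗ[ℂ] W'}
    (h : Adj b T T') (h' : Adj b' S S') :
    Adj (b.tensorProduct b') (TensorProduct.map T S) (TensorProduct.map T' S') := by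
  unfold Adj at *
  rw [TensorProduct.toMatrix_map, TensorProduct.toMatrix_map, h, h', Matrix.conjTranspose_kronecker]

lemma Adj.tpow {b : Module.Basis I ℂ W} {T T' : W →ₗ[ℂ] W} (h : Adj b T T') (n : ℕ) :
    Adj (Basis.piTensorProduct (fun _ : Fin n => b)) (tpow ℂ n T) (tpow ℂ n T') := by
  unfold Adj at *
  ext i j
  rw [LinearMap.toMatrix_apply, Matrix.conjTranspose_apply, LinearMap.toMatrix_apply,
    Basis.piTensorProduct_apply, Basis.piTensorProduct_apply, tpow_tprod, tpow_tprod,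
    Basis.piTensorProduct_repr_tprod_apply, Basis.piTensorProduct_repr_tprod_apply, star_prod]
  refine Finset.prod_congr rfl fun k _ => ?_
  have := congrFun (congrFun h (i k)) (j k)
  rwa [LinearMap.toMatrix_apply, Matrix.conjTranspose_apply, LinearMap.toMatrix_apply] at this

lemma exists_adj (b : Module.Basis I ℂ W) (g : W ≃ₗ[ℂ] W) :
    ∃ g' : W ≃ₗ[ℂ] W, Adj b g.toLinearMap g'.toLinearMap := by
  have e1 : LinearMap.toMatrix b b g.toLinearMap * LinearMap.toMatrix b b g.symm.toLinearMap = 1 := by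
    rw [← LinearMap.toMatrix_comp, LinearEquiv.comp_symm, LinearMap.toMatrix_id]
  have e2 : LinearMap.toMatrix b b g.symm.toLinearMap * LinearMap.toMatrix b b g.toLinearMap = 1 := by
    rw [← LinearMap.toMatrix_comp, LinearEquiv.symm_comp, LinearMap.toMatrix_id]
  refine ⟨LinearEquiv.ofLinear (Matrix.toLin b b (LinearMap.toMatrix b b g.toLinearMap).conjTranspose)
    (Matrix.toLin b b (LinearMap.toMatrix b b g.symm.toLinearMap).conjTranspose) ?_ ?_, ?_⟩
  · rw [← Matrix.toLin_mul, ← Matrix.conjTranspose_mul, e2, Matrix.conjTranspose_one, Matrix.toLin_one]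
  · rw [← Matrix.toLin_mul, ← Matrix.conjTranspose_mul, e1, Matrix.conjTranspose_one, Matrix.toLin_one]
  · unfold Adj
    change LinearMap.toMatrix b b (Matrix.toLin b b _) = _
    rw [LinearMap.toMatrix_toLin]

end adj
end HD

namespace HD

section reps
variable {G : Type*} [Group G] {W W' : Type*} [AddCommGroup W] [Module ℂ W] [AddCommGroup W'] [Module ℂ W']

abbrev SSR (ρ : Representation ℂ G W) : Prop := IsSemisimpleModule (MonoidAlgebra ℂ G) ρ.asModule

lemma ss_inj (ρ : Representation ℂ G W) (σ : Representation ℂ G W') (f : W →ₗ[ℂ] W')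
    (hf : ∀ g v, f (ρ g v) = σ g (f v)) (hi : Function.Injective f) (h : SSR σ) : SSR ρ := by
  let F := Representation.IntertwiningMap.equivLinearMapAsModule ρ σ
    (f.intertwiningMap_of_isIntertwiningMap ρ σ hf)
  have hF : Function.Injective F := hi
  exact IsSemisimpleModule.of_injective F hF

lemma ss_dsum {ι : Type*} {V : ι → Type*} [∀ i, AddCommGroup (V i)] [∀ i, Module ℂ (V i)]
    (ρ : ∀ i, Representation ℂ G (V i)) (h : ∀ i, SSR (ρ i)) : SSR (Representation.directSum ρ) := by
  let F := fun i => Representation.IntertwiningMap.equivLinearMapAsModule (ρ i) (Representation.directSum ρ)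
    ((DirectSum.lof ℂ ι V i).intertwiningMap_of_isIntertwiningMap (ρ i) (Representation.directSum ρ) (by
      intro g v
      simp [Representation.directSum]))
  refine isSemisimpleModule_of_isSemisimpleModule_submodule' (p := fun i => LinearMap.range (F i))
    (fun i => IsSemisimpleModule.range (F i)) ?_
  rw [eq_top_iff]
  intro x _
  have key : ∀ y : (⨁ i, V i), (Representation.directSum ρ).asModuleEquiv.symm y ∈ ⨆ i, LinearMap.range (F i) := by
    intro y
    induction y using DirectSum.induction_on with
    | zero => rw [map_zero]; exact Submodule.zero_mem _
    | add a b ha hb => rw [map_add]; exact Submodule.add_mem _ ha hb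
    | of i a =>
      exact Submodule.mem_iSup_of_mem i ⟨(ρ i).asModuleEquiv.symm a, rfl⟩
  exact key x

theorem iso_of_char [FiniteDimensional ℂ W] [FiniteDimensional ℂ W'] (ρ : Representation ℂ G W)
    (σ : Representation ℂ G W') (h1 : SSR ρ) (h2 : SSR σ)
    (h : ∀ g, LinearMap.trace ℂ W (ρ g) = LinearMap.trace ℂ W' (σ g)) :
    ∃ e : W ≃ₗ[ℂ] W', ∀ g v, e (ρ g v) = σ g (e v) := by
  haveI := h1
  haveI := h2
  have htr : ∀ r : MonoidAlgebra ℂ G, tr (MonoidAlgebra ℂ G) ρ.asModule r = tr (MonoidAlgebra ℂ G) σ.asModule r := by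
    intro r
    have e1 : tr (MonoidAlgebra ℂ G) ρ.asModule r = LinearMap.trace ℂ W (ρ.asAlgebraHom r) := rfl
    have e2 : tr (MonoidAlgebra ℂ G) σ.asModule r = LinearMap.trace ℂ W' (σ.asAlgebraHom r) := rfl
    rw [e1, e2]
    induction r using MonoidAlgebra.induction_linear with
    | zero => simp
    | add x y hx hy =>
      rw [map_add, map_add, map_add, map_add, hx rfl rfl, hy rfl rfl]
    | single g a =>
      rw [Representation.asAlgebraHom_single, Representation.asAlgebraHom_single, map_smul, map_smul, h]
  obtain ⟨E⟩ := iso_of_trace (R := MonoidAlgebra ℂ G) _ ρ.asModule σ.asModule le_rfl htr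
  let f := (Representation.IntertwiningMap.equivLinearMapAsModule ρ σ).symm E.toLinearMap
  refine ⟨LinearEquiv.ofBijective f.toLinearMap ⟨E.injective, E.surjective⟩, fun g v => ?_⟩
  exact LinearMap.congr_fun (f.isIntertwining' g) v

lemma trace_dsum {ι : Type*} [Fintype ι] {V : ι → Type*} [∀ i, AddCommGroup (V i)] [∀ i, Module ℂ (V i)]
    [∀ i, FiniteDimensional ℂ (V i)] (f : ∀ i, V i →ₗ[ℂ] V i) :
    LinearMap.trace ℂ (⨁ i, V i) (DirectSum.lmap f) = ∑ i, LinearMap.trace ℂ (V i) (f i) := by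
  have hid : (DirectSum.lmap f : (⨁ i, V i) →ₗ[ℂ] ⨁ i, V i) =
      ∑ i, (DirectSum.lof ℂ ι V i ∘ₗ f i) ∘ₗ DirectSum.component ℂ ι V i := by
    apply DirectSum.linearMap_ext
    intro i
    ext v
    simp only [LinearMap.comp_apply, LinearMap.sum_apply, DirectSum.lmap_lof]
    rw [Finset.sum_eq_single i]
    · rw [DirectSum.component.lof_self]
    · intro j _ hj
      rw [DirectSum.component.of, dif_neg (Ne.symm hj), map_zero, map_zero]
    · simp
  rw [hid, map_sum]
  refine Finset.sum_congr rfl fun i _ => ?_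
  rw [LinearMap.trace_comp_comm', ← LinearMap.comp_assoc]
  congr 1
  ext v
  simp [DirectSum.component.lof_self]

end reps
end HD

namespace HD
open Partition'

section assemble
variable {G : Type*} [Group G] {M N : Type*} [AddCommGroup M] [Module ℂ M] [AddCommGroup N] [Module ℂ N]

noncomputable def tpRep (n : ℕ) (φ : Representation ℂ G M) :
    Representation ℂ G (PiTensorProduct ℂ (fun _ : Fin n => M)) where
  toFun g := tpow ℂ n (φ g)
  map_one' := by rw [map_one, tpow_one]
  map_mul' g h := by rw [map_mul, Module.End.mul_eq_comp, tpow_mul]; rfl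

noncomputable def scRep (l : Partition') (φ : Representation ℂ G M) :
    Representation ℂ G (schur ℂ l M) where
  toFun g := (tpow ℂ (size l) (φ g)).restrict (schur_inv l (φ g))
  map_one' := by
    ext x
    simp [tpow_one, LinearMap.restrict_apply]
  map_mul' g h := by
    ext x
    simp [Module.End.mul_eq_comp, tpow_mul, LinearMap.restrict_apply]

noncomputable def teRep (φ : Representation ℂ G M) (ψ : Representation ℂ G N) : Representation ℂ G (M ⊗[ℂ] N) where
  toFun g := TensorProduct.map (φ g) (ψ g)
  map_one' := by simp
  map_mul' g h := by simp only [map_mul, Module.End.mul_eq_comp, TensorProduct.map_comp]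

noncomputable def prRep (φ : Representation ℂ G M) (ψ : Representation ℂ G N) : Representation ℂ G (M × N) where
  toFun g := LinearMap.prodMap (φ g) (ψ g)
  map_one' := by ext <;> simp
  map_mul' g h := by ext <;> simp

noncomputable def rep₁ (M N : Type*) [AddCommGroup M] [Module ℂ M] [AddCommGroup N] [Module ℂ N] :
    Representation ℂ ((M ≃ₗ[ℂ] M) × (N ≃ₗ[ℂ] N)) M where
  toFun g := g.1.toLinearMap
  map_one' := rfl
  map_mul' _ _ := rfl

noncomputable def rep₂ (M N : Type*) [AddCommGroup M] [Module ℂ M] [AddCommGroup N] [Module ℂ N] :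
    Representation ℂ ((M ≃ₗ[ℂ] M) × (N ≃ₗ[ℂ] N)) N where
  toFun g := g.2.toLinearMap
  map_one' := rfl
  map_mul' _ _ := rfl

variable {I J : Type*} [Fintype I] [DecidableEq I] [Fintype J] [DecidableEq J]
  (b₁ : Module.Basis I ℂ M) (b₂ : Module.Basis J ℂ N)

lemma exists_adj₂ (g : (M ≃ₗ[ℂ] M) × (N ≃ₗ[ℂ] N)) :
    ∃ g', Adj b₁ (rep₁ M N g) (rep₁ M N g') ∧ Adj b₂ (rep₂ M N g) (rep₂ M N g') := by
  obtain ⟨a, ha⟩ := exists_adj b₁ g.1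
  obtain ⟨c, hc⟩ := exists_adj b₂ g.2
  exact ⟨(a, c), ha, hc⟩

noncomputable abbrev repX (M N : Type*) [AddCommGroup M] [Module ℂ M] [AddCommGroup N] [Module ℂ N] :
    Representation ℂ ((M ≃ₗ[ℂ] M) × (N ≃ₗ[ℂ] N)) (M × (M ⊗[ℂ] N) × N) :=
  prRep (rep₁ M N) (prRep (teRep (rep₁ M N) (rep₂ M N)) (rep₂ M N))

lemma ssX (b₁ : Module.Basis I ℂ M) (b₂ : Module.Basis J ℂ N) (nu : Partition') :
    SSR (G := (M ≃ₗ[ℂ] M) × (N ≃ₗ[ℂ] N)) (W := schur ℂ nu (M × (M ⊗[ℂ] N) × N)) (scRep nu (repX M N)) := by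
  refine ss_inj _ (tpRep (size nu) (repX M N)) (schur ℂ nu _).subtype (fun g v => rfl)
    (Submodule.injective_subtype _) ?_
  refine ss_of_adj _ (Basis.piTensorProduct (fun _ => b₁.prod ((b₁.tensorProduct b₂).prod b₂))) fun g => ?_
  obtain ⟨g', h1, h2⟩ := exists_adj₂ b₁ b₂ g
  exact ⟨g', Adj.tpow (h1.prod ((h1.tensor h2).prod h2)) _⟩

lemma ssY (b₁ : Module.Basis I ℂ M) (b₂ : Module.Basis J ℂ N) (l m : Partition') :
    SSR (G := (M ≃ₗ[ℂ] M) × (N ≃ₗ[ℂ] N)) (W := schur ℂ l M ⊗[ℂ] schur ℂ m N) (teRep (scRep l (rep₁ M N)) (scRep m (rep₂ M N))) := by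
  refine ss_inj _ (teRep (tpRep (size l) (rep₁ M N)) (tpRep (size m) (rep₂ M N)))
    (TensorProduct.map (schur ℂ l M).subtype (schur ℂ m N).subtype) ?_
    (TensorProduct.map_injective_of_flat_flat _ _ (Submodule.injective_subtype _) (Submodule.injective_subtype _)) ?_
  · intro g v
    have : TensorProduct.map (schur ℂ l M).subtype (schur ℂ m N).subtype ∘ₗ
        (teRep (scRep l (rep₁ M N)) (scRep m (rep₂ M N)) g) =
        (teRep (tpRep (size l) (rep₁ M N)) (tpRep (size m) (rep₂ M N)) g) ∘ₗ
        TensorProduct.map (schur ℂ l M).subtype (schur ℂ m N).subtype := by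
      apply TensorProduct.ext'
      intro x y
      rfl
    exact LinearMap.congr_fun this v
  · refine ss_of_adj _ ((Basis.piTensorProduct (fun _ => b₁)).tensorProduct (Basis.piTensorProduct (fun _ => b₂)))
      fun g => ?_
    obtain ⟨g', h1, h2⟩ := exists_adj₂ b₁ b₂ g
    exact ⟨g', (h1.tpow _).tensor (h2.tpow _)⟩

lemma traceX (nu : Partition') (g : (M ≃ₗ[ℂ] M) × (N ≃ₗ[ℂ] N)) :
    LinearMap.trace ℂ _ (scRep nu (repX M N) g) =
      ∑ l ∈ FP (size nu + size nu), ∑ m ∈ FP (size nu + size nu), (aguiar l m nu : ℂ) *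
        (S l (LinearMap.toMatrix b₁ b₁ g.1.toLinearMap) * S m (LinearMap.toMatrix b₂ b₂ g.2.toLinearMap)) := by
  haveI : FiniteDimensional ℂ M := Module.Finite.of_basis b₁
  haveI : FiniteDimensional ℂ N := Module.Finite.of_basis b₂
  rw [← S_main]
  refine (trace_schur (b₁.prod ((b₁.tensorProduct b₂).prod b₂)) nu (repX M N g) (schur_inv nu _)).trans ?_
  change SS _ _ (LinearMap.toMatrix _ _ (LinearMap.prodMap g.1.toLinearMap
    (LinearMap.prodMap (TensorProduct.map g.1.toLinearMap g.2.toLinearMap) g.2.toLinearMap))) = _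
  rw [LinearMap.toMatrix_prodMap, LinearMap.toMatrix_prodMap, TensorProduct.toMatrix_map]
  unfold S
  rw [← SS_submatrix nu _ (Equiv.sumAssoc I (I × J) J)]
  congr 1
  ext x y
  rcases x with (x | x) | x <;> rcases y with (y | y) | y <;> rfl

lemma traceXY_term (l m : Partition') (g : (M ≃ₗ[ℂ] M) × (N ≃ₗ[ℂ] N)) :
    LinearMap.trace ℂ _ (teRep (scRep l (rep₁ M N)) (scRep m (rep₂ M N)) g) =
      S l (LinearMap.toMatrix b₁ b₁ g.1.toLinearMap) * S m (LinearMap.toMatrix b₂ b₂ g.2.toLinearMap) := by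
  haveI : FiniteDimensional ℂ M := Module.Finite.of_basis b₁
  haveI : FiniteDimensional ℂ N := Module.Finite.of_basis b₂
  refine (LinearMap.trace_tensorProduct' (scRep l (rep₁ M N) g) (scRep m (rep₂ M N) g)).trans ?_
  exact congrArg₂ (· * ·) (trace_schur b₁ l (rep₁ M N g) (schur_inv l _))
    (trace_schur b₂ m (rep₂ M N g) (schur_inv m _))

abbrev Idx (nu : Partition') := ((p : Partition' × Partition') × Fin (aguiar p.1 p.2 nu))

lemma idx_mem {nu : Partition'} (i : Idx nu) :
    i.1 ∈ (FP (size nu + size nu)) ×ˢ (FP (size nu + size nu)) := by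
  rw [Finset.mem_product]
  by_contra h
  have h0 := aguiar_zero h
  have := i.2.isLt
  omega

lemma idx_finite (nu : Partition') : Finite (Idx nu) := by
  let f : Idx nu → ((p : {p // p ∈ (FP (size nu + size nu)) ×ˢ (FP (size nu + size nu))}) ×
      Fin (aguiar p.1.1 p.1.2 nu)) := fun i => ⟨⟨i.1, idx_mem i⟩, i.2⟩
  refine Finite.of_injective f ?_
  rintro ⟨p, x⟩ ⟨q, y⟩ h
  simp only [f, Sigma.mk.injEq, Subtype.mk.injEq] at h
  obtain ⟨rfl, h⟩ := h
  rw [eq_of_heq h]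

lemma idx_sum (nu : Partition') [Fintype (Idx nu)] (F : Partition' × Partition' → ℂ) :
    ∑ i : Idx nu, F i.1 = ∑ l ∈ FP (size nu + size nu), ∑ m ∈ FP (size nu + size nu), (aguiar l m nu : ℂ) * F (l, m) := by
  have h1 : (Finset.univ : Finset (Idx nu)) =
      ((FP (size nu + size nu)) ×ˢ (FP (size nu + size nu))).sigma (fun p => Finset.univ) := by
    ext i
    simp only [Finset.mem_univ, Finset.mem_sigma, and_true, true_iff]
    exact idx_mem i
  rw [h1, Finset.sum_sigma, Finset.sum_product]
  refine Finset.sum_congr rfl fun l _ => Finset.sum_congr rfl fun m _ => ?_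
  simp

theorem iso_dsum {W : Type*} [AddCommGroup W] [Module ℂ W] [FiniteDimensional ℂ W]
    {ι : Type*} [Fintype ι] [DecidableEq ι] {V : ι → Type*} [∀ i, AddCommGroup (V i)] [∀ i, Module ℂ (V i)]
    [∀ i, FiniteDimensional ℂ (V i)] (σ : Representation ℂ G W) (ρ : ∀ i, Representation ℂ G (V i))
    (h1 : SSR σ) (h2 : ∀ i, SSR (ρ i))
    (h : ∀ g, LinearMap.trace ℂ W (σ g) = ∑ i, LinearMap.trace ℂ (V i) (ρ i g)) :
    ∃ e : W ≃ₗ[ℂ] ⨁ i, V i, ∀ g, e.toLinearMap ∘ₗ σ g =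
      (DirectSum.toModule ℂ _ _ fun i => DirectSum.lof ℂ _ V i ∘ₗ ρ i g) ∘ₗ e.toLinearMap := by
  haveI : FiniteDimensional ℂ (⨁ i, V i) := inferInstance
  obtain ⟨e, he⟩ := iso_of_char σ (Representation.directSum ρ) h1 (ss_dsum ρ h2) (fun g =>
    (h g).trans (trace_dsum (fun i => ρ i g)).symm)
  refine ⟨e, fun g => ?_⟩
  have hY2 : Representation.directSum ρ g = DirectSum.toModule ℂ _ _ fun i =>
      DirectSum.lof ℂ _ V i ∘ₗ ρ i g := by
    apply DirectSum.linearMap_ext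
    intro i
    ext v : 1
    simp [Representation.directSum, DirectSum.toModule_lof]
  apply LinearMap.ext
  intro v
  refine (he g v).trans ?_
  rw [hY2]
  rfl

end assemble
end HD

namespace HD
open Partition'
variable {M N : Type*} [AddCommGroup M] [Module ℂ M] [AddCommGroup N] [Module ℂ N] {I J : Type*} [Fintype I] [DecidableEq I] [Fintype J] [DecidableEq J]
  (b₁ : Module.Basis I ℂ M) (b₂ : Module.Basis J ℂ N)

abbrev VY (M N : Type*) [AddCommGroup M] [Module ℂ M] [AddCommGroup N] [Module ℂ N] (nu : Partition') (i : Idx nu) :=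
  schur ℂ i.1.1 M ⊗[ℂ] schur ℂ i.1.2 N

noncomputable def repY (M N : Type*) [AddCommGroup M] [Module ℂ M] [AddCommGroup N] [Module ℂ N] (nu : Partition') (i : Idx nu) :
    Representation ℂ ((M ≃ₗ[ℂ] M) × (N ≃ₗ[ℂ] N)) (VY M N nu i) :=
  teRep (scRep i.1.1 (rep₁ M N)) (scRep i.1.2 (rep₂ M N))

noncomputable def repXS (M N : Type*) [AddCommGroup M] [Module ℂ M] [AddCommGroup N] [Module ℂ N] (nu : Partition') :
    Representation ℂ ((M ≃ₗ[ℂ] M) × (N ≃ₗ[ℂ] N)) (schur ℂ nu (M × (M ⊗[ℂ] N) × N)) :=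
  scRep nu (repX M N)

lemma ssX2 (b₁ : Module.Basis I ℂ M) (b₂ : Module.Basis J ℂ N) (nu : Partition') :
    SSR (G := (M ≃ₗ[ℂ] M) × (N ≃ₗ[ℂ] N)) (W := schur ℂ nu (M × (M ⊗[ℂ] N) × N)) (repXS M N nu) := ssX b₁ b₂ nu

lemma ssY2 (b₁ : Module.Basis I ℂ M) (b₂ : Module.Basis J ℂ N) (nu : Partition') (i : Idx nu) :
    SSR (G := (M ≃ₗ[ℂ] M) × (N ≃ₗ[ℂ] N)) (W := VY M N nu i) (repY M N nu i) := ssY b₁ b₂ i.1.1 i.1.2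

lemma htr (b₁ : Module.Basis I ℂ M) (b₂ : Module.Basis J ℂ N) (nu : Partition') [Fintype (Idx nu)]
    (g : (M ≃ₗ[ℂ] M) × (N ≃ₗ[ℂ] N)) :
    LinearMap.trace ℂ (schur ℂ nu (M × (M ⊗[ℂ] N) × N)) (repXS M N nu g) =
      ∑ i : Idx nu, LinearMap.trace ℂ (VY M N nu i) (repY M N nu i g) := by
  refine (traceX b₁ b₂ nu g).trans ?_
  refine Eq.trans ?_ (Finset.sum_congr rfl fun i _ => (traceXY_term b₁ b₂ i.1.1 i.1.2 g).symm)
  exact (idx_sum nu (fun p => S p.1 (LinearMap.toMatrix b₁ b₁ g.1.toLinearMap) *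
        S p.2 (LinearMap.toMatrix b₂ b₂ g.2.toLinearMap))).symm

lemma final (b₁ : Module.Basis I ℂ M) (b₂ : Module.Basis J ℂ N) (nu : Partition') :
    ∃ e : schur ℂ nu (M × (M ⊗[ℂ] N) × N) ≃ₗ[ℂ] ⨁ i, VY M N nu i, ∀ g, e.toLinearMap ∘ₗ repXS M N nu g =
      (DirectSum.toModule ℂ _ _ fun i => DirectSum.lof ℂ _ (VY M N nu) i ∘ₗ repY M N nu i g) ∘ₗ e.toLinearMap := by
  haveI := idx_finite nu
  letI := Fintype.ofFinite (Idx nu)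
  haveI : FiniteDimensional ℂ M := Module.Finite.of_basis b₁
  haveI : FiniteDimensional ℂ N := Module.Finite.of_basis b₂
  haveI f1 : FiniteDimensional ℂ (schur ℂ nu (M × (M ⊗[ℂ] N) × N)) := FiniteDimensional.finiteDimensional_submodule _
  haveI f2 : ∀ i : Idx nu, FiniteDimensional ℂ (VY M N nu i) := fun i => by
    haveI : FiniteDimensional ℂ (schur ℂ i.1.1 M) := FiniteDimensional.finiteDimensional_submodule _
    haveI : FiniteDimensional ℂ (schur ℂ i.1.2 N) := FiniteDimensional.finiteDimensional_submodule _
    exact Module.Finite.tensorProduct ℂ _ _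
  have h1 := ssX2 b₁ b₂ nu
  have h2 := ssY2 b₁ b₂ nu
  have h3 := htr b₁ b₂ nu
  exact @iso_dsum ((M ≃ₗ[ℂ] M) × (N ≃ₗ[ℂ] N)) _ (schur ℂ nu (M × (M ⊗[ℂ] N) × N)) _ _ f1 (Idx nu) _ _
    (VY M N nu) _ _ f2 (repXS M N nu) (repY M N nu) h1 h2 h3

end HD

open Partition' in
/-- for finite dimensional complex vector spaces `V₁, V₂` and a partition `ν`
of length at most `dim V₁ + dim V₁ · dim V₂ + dim V₂`, the Schur module
`S^ν(V₁ ⊕ (V₁ ⊗ V₂) ⊕ V₂)` — invariant under the natural action of `GL(V₁) × GL(V₂)`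
(by `g₁` on `V₁`, `g₂` on `V₂` and `g₁ ⊗ g₂` on `V₁ ⊗ V₂`) — decomposes
`GL(V₁) × GL(V₂)`-equivariantly as `⊕_{λ,μ} (S^λ V₁ ⊗ S^μ V₂)^{⊕ a_{λ,μ}^ν}`, where `a`
are the Aguiar coefficients. -/
theorem schurModule_heisenberg_decomposition (V₁ V₂ : Type) [AddCommGroup V₁] [Module ℂ V₁]
    [AddCommGroup V₂] [Module ℂ V₂] [FiniteDimensional ℂ V₁] [FiniteDimensional ℂ V₂]
    (nu : Partition')
    (hlen : plength nu ≤ Module.finrank ℂ V₁ +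
      Module.finrank ℂ V₁ * Module.finrank ℂ V₂ + Module.finrank ℂ V₂) :
    ∃ (hinv : ∀ (g₁ : V₁ ≃ₗ[ℂ] V₁) (g₂ : V₂ ≃ₗ[ℂ] V₂),
        ∀ x ∈ schur ℂ nu (V₁ × (V₁ ⊗[ℂ] V₂) × V₂),
          tpow ℂ (size nu)
              (LinearMap.prodMap g₁.toLinearMap
                (LinearMap.prodMap (TensorProduct.map g₁.toLinearMap g₂.toLinearMap)
                  g₂.toLinearMap)) x ∈
            schur ℂ nu (V₁ × (V₁ ⊗[ℂ] V₂) × V₂))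
      (hinv₁ : ∀ (l : Partition') (g₁ : V₁ ≃ₗ[ℂ] V₁),
        ∀ x ∈ schur ℂ l V₁, tpow ℂ (size l) g₁.toLinearMap x ∈ schur ℂ l V₁)
      (hinv₂ : ∀ (m : Partition') (g₂ : V₂ ≃ₗ[ℂ] V₂),
        ∀ x ∈ schur ℂ m V₂, tpow ℂ (size m) g₂.toLinearMap x ∈ schur ℂ m V₂)
      (e : schur ℂ nu (V₁ × (V₁ ⊗[ℂ] V₂) × V₂) ≃ₗ[ℂ]
        ⨁ (i : ((p : Partition' × Partition') × Fin (aguiar p.1 p.2 nu))),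
          ((schur ℂ i.1.1 V₁) ⊗[ℂ] (schur ℂ i.1.2 V₂))),
      ∀ (g₁ : V₁ ≃ₗ[ℂ] V₁) (g₂ : V₂ ≃ₗ[ℂ] V₂),
        e.toLinearMap ∘ₗ
            (tpow ℂ (size nu)
                (LinearMap.prodMap g₁.toLinearMap
                  (LinearMap.prodMap (TensorProduct.map g₁.toLinearMap g₂.toLinearMap)
                    g₂.toLinearMap))).restrict (hinv g₁ g₂) =
          (DirectSum.toModule ℂ _ _ fun i =>
            (DirectSum.lof ℂ _
                (fun i : ((p : Partition' × Partition') × Fin (aguiar p.1 p.2 nu)) =>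
                  ((schur ℂ i.1.1 V₁) ⊗[ℂ] (schur ℂ i.1.2 V₂))) i) ∘ₗ
              TensorProduct.map
                ((tpow ℂ (size i.1.1) g₁.toLinearMap).restrict (hinv₁ i.1.1 g₁))
                ((tpow ℂ (size i.1.2) g₂.toLinearMap).restrict (hinv₂ i.1.2 g₂))) ∘ₗ
            e.toLinearMap := by
  refine ⟨fun g₁ g₂ => HD.schur_inv nu _, fun l g₁ => HD.schur_inv l _, fun m g₂ => HD.schur_inv m _, ?_⟩
  obtain ⟨e, he⟩ := HD.final (Module.finBasis ℂ V₁) (Module.finBasis ℂ V₂) nu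
  exact ⟨e, fun g₁ g₂ => he (g₁, g₂)⟩
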